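/- arXiv:2401.00783 — 2 statements merged into one kernel-verified Lean document; each statement's English description precedes it below -/
import Mathlib

section
/- Let k be an algebraically closed field of prime characteristic p. For every i ≥ 1, the i-th Frobenius Betti number of R equals (9/4)·2^(i−1); that is, the sequence e ↦ dim_k Tor_i^R(^eR, R/𝔪) / p^(3e) converges to (9/4)·2^(i−1) as e → ∞. -/
open MvPolynomial CategoryTheory Filter

set_option synthInstance.maxHeartbeats 1000000
set_option maxHeartbeats 2000000

noncomputable section

variable (k : Type) [Field k]

/-- The generating monomials `x², xy, y², xz, yz` of the scroll of type `(2,1)`. -/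
def sgen : Set (MvPolynomial (Fin 3) k) :=
  {X 0 ^ 2, X 0 * X 1, X 1 ^ 2, X 0 * X 2, X 1 * X 2}

/-- `R = k[x², xy, y², xz, yz]`, the homogeneous coordinate ring of the scroll of
type `(2,1)`. -/
def Rscr : Subalgebra k (MvPolynomial (Fin 3) k) := Algebra.adjoin k (sgen k)

/-- `x²` as an element of `R`. -/
def gx2 : ↥(Rscr k) := ⟨X 0 ^ 2, Algebra.subset_adjoin (Set.mem_insert _ _)⟩
/-- `xy` as an element of `R`. -/
def gxy : ↥(Rscr k) :=
  ⟨X 0 * X 1, Algebra.subset_adjoin (Set.mem_insert_of_mem _ (Set.mem_insert _ _))⟩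
/-- `y²` as an element of `R`. -/
def gy2 : ↥(Rscr k) :=
  ⟨X 1 ^ 2, Algebra.subset_adjoin
    (Set.mem_insert_of_mem _ (Set.mem_insert_of_mem _ (Set.mem_insert _ _)))⟩
/-- `xz` as an element of `R`. -/
def gxz : ↥(Rscr k) :=
  ⟨X 0 * X 2, Algebra.subset_adjoin
    (Set.mem_insert_of_mem _ (Set.mem_insert_of_mem _ (Set.mem_insert_of_mem _
      (Set.mem_insert _ _))))⟩
/-- `yz` as an element of `R`. -/
def gyz : ↥(Rscr k) :=
  ⟨X 1 * X 2, Algebra.subset_adjoin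
    (Set.mem_insert_of_mem _ (Set.mem_insert_of_mem _ (Set.mem_insert_of_mem _
      (Set.mem_insert_of_mem _ (Set.mem_singleton _)))))⟩

/-- The graded maximal ideal `𝔪 = (x², xy, y², xz, yz)` of `R`. -/
def mScr : Ideal ↥(Rscr k) := Ideal.span {gx2 k, gxy k, gy2 k, gxz k, gyz k}

/-- The `i`-th Betti number `β_i(M) = dim_k Tor_i^R(M, R/𝔪)` of an `R`-module `M`. -/
def bettiScr (i : ℕ) (M : Type) [AddCommGroup M] [Module ↥(Rscr k) M] : ℕ :=
  Module.finrank k (RestrictScalars k ↥(Rscr k)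
    ((((Tor (ModuleCat ↥(Rscr k)) i).obj (ModuleCat.of ↥(Rscr k) M)).obj
      (ModuleCat.of ↥(Rscr k) (↥(Rscr k) ⧸ mScr k)))))

/-- The `e`-th iterated Frobenius endomorphism `r ↦ r^(p^e)` of `R`. -/
def frobRscr (p : ℕ) [Fact p.Prime] [CharP k p] (e : ℕ) : ↥(Rscr k) →+* ↥(Rscr k) :=
  letI : CharP ↥(Rscr k) p :=
    CharP.subsemiring (MvPolynomial (Fin 3) k) p (Rscr k).toSubsemiring
  iterateFrobenius ↥(Rscr k) p e

/-- `^eR` : `R` viewed as an `R`-module by restriction of scalars along the `e`-th iterate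
of the Frobenius endomorphism. -/
def eRscr (p : ℕ) [Fact p.Prime] [CharP k p] (e : ℕ) : ModuleCat ↥(Rscr k) :=
  (ModuleCat.restrictScalars (frobRscr k p e)).obj (ModuleCat.of ↥(Rscr k) ↥(Rscr k))

namespace TorShift

open MonoidalCategory

variable {R : Type} [CommRing R]

/-- The short complex `K ⊗ P → F ⊗ P → M ⊗ P` of chain complexes attached to `K → F → M`. -/
def tensorComplex (S : ShortComplex (ModuleCat R)) (P : ChainComplex (ModuleCat R) ℕ) :
    ShortComplex (ChainComplex (ModuleCat R) ℕ) where
  X₁ := (((tensoringLeft (ModuleCat R)).obj S.X₁).mapHomologicalComplex _).obj P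
  X₂ := (((tensoringLeft (ModuleCat R)).obj S.X₂).mapHomologicalComplex _).obj P
  X₃ := (((tensoringLeft (ModuleCat R)).obj S.X₃).mapHomologicalComplex _).obj P
  f := (NatTrans.mapHomologicalComplex ((tensoringLeft (ModuleCat R)).map S.f) _).app P
  g := (NatTrans.mapHomologicalComplex ((tensoringLeft (ModuleCat R)).map S.g) _).app P
  zero := by
    ext n : 1
    change S.f ▷ P.X n ≫ S.g ▷ P.X n = 0
    rw [← comp_whiskerRight, S.zero]
    exact MonoidalPreadditive.zero_whiskerRight

lemma tensorComplex_shortExact {S : ShortComplex (ModuleCat R)} (hS : S.ShortExact)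
    (P : ChainComplex (ModuleCat R) ℕ) [∀ n, Projective (P.X n)] :
    (tensorComplex S P).ShortExact := by
  apply HomologicalComplex.shortExact_of_degreewise_shortExact
  intro n
  have : Module.Projective R (P.X n) := by
    rw [IsProjective.iff_projective]
    exact (inferInstance : Projective (P.X n))
  exact hS.map_of_exact (tensorRight (P.X n))

lemma isZero_Tor_succ_of_flat (F N : ModuleCat R) [Module.Flat R F] (n : ℕ) :
    Limits.IsZero (((Tor (ModuleCat R) (n + 1)).obj F).obj N) := by
  let P := ProjectiveResolution.of N
  refine Limits.IsZero.of_iso ?_ (P.isoLeftDerivedObj ((tensoringLeft (ModuleCat R)).obj F) (n+1))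
  have h := P.complex_exactAt_succ n
  have : Limits.PreservesFiniteLimits (tensorLeft F) := inferInstance
  exact (HomologicalComplex.exactAt_iff_isZero_homology _ _).mp
    ((HomologicalComplex.exactAt_iff _ _).mpr
      (((HomologicalComplex.exactAt_iff _ _).mp h).map (tensorLeft F)))

lemma tor_add_two {S : ShortComplex (ModuleCat R)} (hS : S.ShortExact) [Module.Flat R S.X₂]
    (N : ModuleCat R) (n : ℕ) :
    Nonempty (((Tor (ModuleCat R) (n + 2)).obj S.X₃).obj N ≅
      ((Tor (ModuleCat R) (n + 1)).obj S.X₁).obj N) := by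
  let P := ProjectiveResolution.of N
  have h := tensorComplex_shortExact hS P.complex
  have z (j : ℕ) : Limits.IsZero ((tensorComplex S P.complex).X₂.homology (j+1)) :=
    (isZero_Tor_succ_of_flat S.X₂ N j).of_iso
      (P.isoLeftDerivedObj ((tensoringLeft (ModuleCat R)).obj S.X₂) (j+1)).symm
  exact ⟨P.isoLeftDerivedObj ((tensoringLeft (ModuleCat R)).obj S.X₃) (n+2) ≪≫
    h.δIso (n+2) (n+1) (by simp) (z _) (z _) ≪≫
    (P.isoLeftDerivedObj ((tensoringLeft (ModuleCat R)).obj S.X₁) (n+1)).symm⟩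

lemma tor_one {S : ShortComplex (ModuleCat R)} (hS : S.ShortExact) [Module.Flat R S.X₂]
    (N : ModuleCat R) :
    ∃ (A B C : ModuleCat R) (α : ((Tor (ModuleCat R) 1).obj S.X₃).obj N ⟶ A) (β : A ⟶ B)
      (γ : B ⟶ C), Function.Injective α ∧ Function.Exact α β ∧
        Function.Exact β γ ∧ Function.Surjective γ ∧ Nonempty (A ≅ S.X₁ ⊗ N) ∧
        Nonempty (B ≅ S.X₂ ⊗ N) ∧ Nonempty (C ≅ S.X₃ ⊗ N) := by
  let P := ProjectiveResolution.of N
  have h := tensorComplex_shortExact hS P.complex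
  have z : Limits.IsZero ((tensorComplex S P.complex).X₂.homology 1) :=
    (isZero_Tor_succ_of_flat S.X₂ N 0).of_iso
      (P.isoLeftDerivedObj ((tensoringLeft (ModuleCat R)).obj S.X₂) 1).symm
  have e (X : ModuleCat R) : Nonempty (((((tensoringLeft (ModuleCat R)).obj X).mapHomologicalComplex
      _).obj P.complex).homology 0 ≅ X ⊗ N) :=
    have : Limits.PreservesFiniteColimits ((tensoringLeft (ModuleCat R)).obj X) :=
      inferInstanceAs (Limits.PreservesFiniteColimits (tensorLeft X))
    ⟨(P.isoLeftDerivedObj ((tensoringLeft (ModuleCat R)).obj X) 0).symm ≪≫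
      ((tensoringLeft (ModuleCat R)).obj X).leftDerivedZeroIsoSelf.app N⟩
  have hm := h.mono_δ 1 0 (by simp) z
  have : Epi (tensorComplex S P.complex).g := h.epi_g
  have he := HomologicalComplex.epi_homologyMap_of_epi_of_not_rel (tensorComplex S P.complex).g 0
    (by simp)
  let i : ((Tor (ModuleCat R) 1).obj S.X₃).obj N ≅ (tensorComplex S P.complex).X₃.homology 1 :=
    P.isoLeftDerivedObj ((tensoringLeft (ModuleCat R)).obj S.X₃) 1
  refine ⟨(tensorComplex S P.complex).X₁.homology 0, (tensorComplex S P.complex).X₂.homology 0,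
    (tensorComplex S P.complex).X₃.homology 0, i.hom ≫ h.δ 1 0 (by simp),
    HomologicalComplex.homologyMap (tensorComplex S P.complex).f 0,
    HomologicalComplex.homologyMap (tensorComplex S P.complex).g 0, ?_, ?_, ?_, ?_, e _, e _, e _⟩
  · exact (ModuleCat.mono_iff_injective _).mp (mono_comp _ _)
  · have := (ShortComplex.ShortExact.moduleCat_exact_iff_function_exact _).mp
      (h.homology_exact₁ 1 0 (by simp))
    intro x
    rw [this x]
    constructor
    · rintro ⟨y, rfl⟩
      refine ⟨i.inv y, ?_⟩
      exact congrArg (h.δ 1 0 (by simp)) (i.toLinearEquiv.apply_symm_apply y)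
    · rintro ⟨y, rfl⟩
      exact ⟨i.hom y, rfl⟩
  · exact (ShortComplex.ShortExact.moduleCat_exact_iff_function_exact _).mp (h.homology_exact₂ 0)
  · exact (ModuleCat.epi_iff_surjective _).mp he

/-- The `k`-dimension of a module over a `k`-algebra `R`. -/
def kdim (k R X : Type) [Field k] [CommRing R] [Algebra k R] [AddCommGroup X] [Module R X] : ℕ :=
  letI := Module.compHom X (algebraMap k R)
  Module.finrank k X

/-- Finite-dimensionality over `k` of a module over a `k`-algebra `R`. -/
def KFinite (k R X : Type) [Field k] [CommRing R] [Algebra k R] [AddCommGroup X] [Module R X] :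
    Prop :=
  letI := Module.compHom X (algebraMap k R)
  Module.Finite k X

section kdim

variable (k : Type) {R X Y Z : Type} [Field k] [CommRing R] [Algebra k R] [AddCommGroup X]
  [Module R X] [AddCommGroup Y] [Module R Y] [AddCommGroup Z] [Module R Z]

lemma kdim_eq_finrank [Module k X] [IsScalarTower k R X] : kdim k R X = Module.finrank k X := by
  have : Module.compHom X (algebraMap k R) = ‹Module k X› := by
    ext c x
    exact algebraMap_smul R c x
  rw [kdim, this]

lemma kfinite_iff [Module k X] [IsScalarTower k R X] : KFinite k R X ↔ Module.Finite k X := by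
  have : Module.compHom X (algebraMap k R) = ‹Module k X› := by
    ext c x
    exact algebraMap_smul R c x
  rw [KFinite, this]

lemma isScalarTower_compHom :
    letI := Module.compHom X (algebraMap k R)
    IsScalarTower k R X :=
  IsScalarTower.of_compHom k R X

lemma kdim_eq_add_of_exact {α : X →ₗ[R] Y} {β : Y →ₗ[R] Z} (hα : Function.Injective α)
    (h : Function.Exact α β) (hβ : Function.Surjective β) (hY : KFinite k R Y) :
    kdim k R Y = kdim k R X + kdim k R Z := by
  let := Module.compHom X (algebraMap k R)
  let := Module.compHom Y (algebraMap k R)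
  let := Module.compHom Z (algebraMap k R)
  have := isScalarTower_compHom k (R := R) (X := X)
  have := isScalarTower_compHom k (R := R) (X := Y)
  have := isScalarTower_compHom k (R := R) (X := Z)
  rw [kfinite_iff] at hY
  simp only [kdim_eq_finrank]
  let α' := α.restrictScalars k
  let β' := β.restrictScalars k
  have h1 := β'.finrank_range_add_finrank_ker
  rw [LinearMap.range_eq_top.mpr (show Function.Surjective β' from hβ), finrank_top,
    LinearMap.exact_iff.mp (show Function.Exact α' β' from h),
    LinearMap.finrank_range_of_inj (show Function.Injective α' from hα)] at h1
  rw [← h1, add_comm]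

lemma kdim_congr (e : X ≃ₗ[R] Y) : kdim k R X = kdim k R Y := by
  let := Module.compHom X (algebraMap k R)
  let := Module.compHom Y (algebraMap k R)
  have := isScalarTower_compHom k (R := R) (X := X)
  have := isScalarTower_compHom k (R := R) (X := Y)
  simp only [kdim_eq_finrank]
  exact (e.restrictScalars k).finrank_eq

variable {k}

lemma KFinite.of_injective (hY : KFinite k R Y) {α : X →ₗ[R] Y} (hα : Function.Injective α) :
    KFinite k R X := by
  let := Module.compHom X (algebraMap k R)
  let := Module.compHom Y (algebraMap k R)
  have := isScalarTower_compHom k (R := R) (X := X)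
  have := isScalarTower_compHom k (R := R) (X := Y)
  rw [kfinite_iff] at *
  exact Module.Finite.of_injective (α.restrictScalars k) hα

lemma KFinite.of_surjective (hX : KFinite k R X) {α : X →ₗ[R] Y} (hα : Function.Surjective α) :
    KFinite k R Y := by
  let := Module.compHom X (algebraMap k R)
  let := Module.compHom Y (algebraMap k R)
  have := isScalarTower_compHom k (R := R) (X := X)
  have := isScalarTower_compHom k (R := R) (X := Y)
  rw [kfinite_iff] at *
  exact Module.Finite.of_surjective (α.restrictScalars k) hα

lemma KFinite.pi (h : KFinite k R X) (n : ℕ) : KFinite k R (Fin n → X) := by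
  let := Module.compHom X (algebraMap k R)
  have := isScalarTower_compHom k (R := R) (X := X)
  rw [kfinite_iff] at *
  infer_instance

lemma kdim_pi (h : KFinite k R X) (n : ℕ) : kdim k R (Fin n → X) = n * kdim k R X := by
  let := Module.compHom X (algebraMap k R)
  have := isScalarTower_compHom k (R := R) (X := X)
  rw [kfinite_iff] at *
  simp only [kdim_eq_finrank]
  rw [Module.finrank_pi_fintype k]
  simp

lemma kdim_prod_self (h : KFinite k R X) : kdim k R (X × X) = 2 * kdim k R X := by
  let := Module.compHom X (algebraMap k R)
  have := isScalarTower_compHom k (R := R) (X := X)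
  rw [kfinite_iff] at *
  simp only [kdim_eq_finrank]
  rw [two_mul, Module.finrank_prod]

end kdim

section free

variable {R : Type} [CommRing R] (I : Ideal R) {n : ℕ}

lemma mem_smul_top_pi (x : Fin n → R) :
    x ∈ (I • ⊤ : Submodule R (Fin n → R)) ↔ ∀ i, x i ∈ I := by
  constructor
  · intro h i
    induction h using Submodule.smul_induction_on' with
    | smul r hr y _ => exact I.mul_mem_right _ hr
    | add y _ z _ hy hz => exact I.add_mem hy hz
  · intro h
    rw [← Finset.univ_sum_single x]
    refine Submodule.sum_mem _ fun i _ => ?_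
    have : Pi.single i (x i) = x i • (Pi.single i 1 : Fin n → R) := by
      rw [← Pi.single_smul, smul_eq_mul, mul_one]
    rw [this]
    exact Submodule.smul_mem_smul (h i) trivial

/-- `Rⁿ / I Rⁿ ≃ (R / I)ⁿ`. -/
def piQuotEquiv : ((Fin n → R) ⧸ (I • ⊤ : Submodule R (Fin n → R))) ≃ₗ[R] (Fin n → R ⧸ I) :=
  (Submodule.quotEquivOfEq _ _ (by
      ext x
      simp only [mem_smul_top_pi, LinearMap.mem_ker, funext_iff, LinearMap.compLeft_apply,
        Function.comp, Submodule.mkQ_apply, Ideal.Quotient.mk_eq_mk,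
        Ideal.Quotient.eq_zero_iff_mem, Pi.zero_apply])).trans
    ((I.mkQ.compLeft (Fin n)).quotKerEquivOfSurjective (by
      intro y
      choose x hx using fun i => Submodule.mkQ_surjective I (y i)
      exact ⟨x, funext hx⟩))

end free

section syzygy

variable {k A R : Type} [Field k] [CommRing A] [CommRing R] [Algebra k R] [Algebra A R]
  {𝔫 : Ideal A} {𝔪 J : Ideal R}
  {M : Type} [AddCommGroup M] [Module R M] [Module A M] [IsScalarTower A R M]
  {n : ℕ} (f : (Fin n → R) →ₗ[R] M)

lemma map_smul_top_eq (hJ : J = 𝔫.map (algebraMap A R)) {X : Type} [AddCommGroup X]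
    [Module R X] [Module A X] [IsScalarTower A R X] :
    (J • ⊤ : Submodule R X).restrictScalars A = 𝔫 • (⊤ : Submodule A X) := by
  rw [hJ, Ideal.smul_restrictScalars, Submodule.restrictScalars_top]

/-- For a projective `A`-module `M`, the kernel of `Rⁿ → M` is an `A`-direct summand. -/
lemma exists_retraction [Module.Projective A M] (hf : Function.Surjective f) :
    ∃ g : (Fin n → R) →ₗ[A] LinearMap.ker f, ∀ x : LinearMap.ker f, g x = x := by
  obtain ⟨s, hs⟩ := LinearMap.exists_rightInverse_of_surjective (f.restrictScalars A)
    (LinearMap.range_eq_top.mpr hf)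
  have hs' (y : M) : f (s y) = y := LinearMap.congr_fun hs y
  refine ⟨{ toFun := fun x => ⟨x - s (f x), by simp [hs']⟩
            map_add' := fun x y => by ext1; simp; abel
            map_smul' := fun a x => by
              ext1
              have : f (a • x) = a • f x := (f.restrictScalars A).map_smul a x
              simp [smul_sub, this] }, fun x => ?_⟩
  ext1
  simp [LinearMap.mem_ker.mp x.2]

lemma projective_ker [Module.Projective A R] [Module.Projective A M] (hf : Function.Surjective f) :
    Module.Projective A (LinearMap.ker f) := by
  have : Module.Projective A (Fin n → R) :=
    .of_equiv' (DirectSum.linearEquivFunOnFintype A (Fin n) fun _ => R)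
  obtain ⟨g, hg⟩ := exists_retraction (A := A) f hf
  exact Module.Projective.of_split ((LinearMap.ker f).subtype.restrictScalars A) g
    (LinearMap.ext hg)

lemma mem_smul_top_ker (hJ : J = 𝔫.map (algebraMap A R)) [Module.Projective A M]
    (hf : Function.Surjective f) (x : LinearMap.ker f) :
    x ∈ (J • ⊤ : Submodule R (LinearMap.ker f)) ↔
      (x : Fin n → R) ∈ (J • ⊤ : Submodule R (Fin n → R)) := by
  obtain ⟨g, hg⟩ := exists_retraction (A := A) f hf
  constructor
  · intro h
    have := Submodule.mem_map_of_mem (f := (LinearMap.ker f).subtype) h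
    rw [Submodule.map_smul''] at this
    exact Submodule.smul_mono le_rfl le_top this
  · intro h
    have h' : (x : Fin n → R) ∈ (J • ⊤ : Submodule R (Fin n → R)).restrictScalars A := h
    change x ∈ (J • ⊤ : Submodule R (LinearMap.ker f)).restrictScalars A
    rw [map_smul_top_eq hJ] at h' ⊢
    have := Submodule.mem_map_of_mem (f := g) h'
    rw [Submodule.map_smul'', hg] at this
    exact Submodule.smul_mono le_rfl le_top this

/-- The map `K / IK → F / IF` induced by the inclusion of a submodule. -/
abbrev quotIncl {X Y : Type} [AddCommGroup X] [Module R X] [AddCommGroup Y] [Module R Y]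
    (I : Ideal R) (g : X →ₗ[R] Y) :
    (X ⧸ (I • ⊤ : Submodule R X)) →ₗ[R] (Y ⧸ (I • ⊤ : Submodule R Y)) :=
  Submodule.mapQ _ _ g (by
    rw [← Submodule.map_le_iff_le_comap, Submodule.map_smul'']
    exact Submodule.smul_mono le_rfl le_top)

lemma quotIncl_surjective (I : Ideal R) (hf : Function.Surjective f) :
    Function.Surjective (quotIncl I f) := by
  intro y
  obtain ⟨y, rfl⟩ := Submodule.mkQ_surjective _ y
  obtain ⟨x, rfl⟩ := hf y
  exact ⟨Submodule.mkQ _ x, rfl⟩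

lemma quotIncl_exact (I : Ideal R) (hf : Function.Surjective f) :
    Function.Exact (quotIncl I (LinearMap.ker f).subtype) (quotIncl I f) := by
  intro y
  obtain ⟨y, rfl⟩ := Submodule.mkQ_surjective _ y
  constructor
  · intro h
    have h : f y ∈ (I • ⊤ : Submodule R M) := (Submodule.Quotient.mk_eq_zero _).mp h
    rw [← LinearMap.range_eq_top.mpr hf, ← Submodule.map_top, ← Submodule.map_smul''] at h
    obtain ⟨z, hz, hzy⟩ := h
    refine ⟨Submodule.mkQ _ ⟨y - z, by simp [hzy]⟩, ?_⟩
    refine (Submodule.Quotient.eq _).mpr ?_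
    simpa using hz
  · rintro ⟨x, hx⟩
    obtain ⟨x, rfl⟩ := Submodule.mkQ_surjective _ x
    rw [← hx]
    simp [quotIncl, Submodule.mapQ_apply]

lemma kdim_ker_J (hf : Function.Surjective f) (hJ : J = 𝔫.map (algebraMap A R))
    [Module.Projective A M]
    (hfin : KFinite k R (R ⧸ J)) :
    kdim k R (LinearMap.ker f ⧸ (J • ⊤ : Submodule R (LinearMap.ker f))) +
      kdim k R (M ⧸ (J • ⊤ : Submodule R M)) = n * kdim k R (R ⧸ J) := by
  have fFJ : KFinite k R ((Fin n → R) ⧸ (J • ⊤ : Submodule R (Fin n → R))) :=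
    (hfin.pi n).of_injective (α := (piQuotEquiv J).toLinearMap) (piQuotEquiv J).injective
  rw [← kdim_pi hfin, ← kdim_congr k (piQuotEquiv J)]
  refine (kdim_eq_add_of_exact k ?_ (quotIncl_exact f J hf) (quotIncl_surjective f J hf) fFJ).symm
  rw [← LinearMap.ker_eq_bot, LinearMap.ker_eq_bot']
  intro x
  obtain ⟨x, rfl⟩ := Submodule.mkQ_surjective _ x
  intro h
  exact (Submodule.Quotient.mk_eq_zero _).mpr ((mem_smul_top_ker f hJ hf x).mpr
    ((Submodule.Quotient.mk_eq_zero _).mp h))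

/-- If `R / J` has square-zero maximal ideal with basis `s, t` over the residue field, the number
of generators of a syzygy module is determined. -/
lemma kdim_ker_m (hJ : J = 𝔫.map (algebraMap A R)) [Module.Projective A M]
    (hfin : KFinite k R (R ⧸ J)) (hJm : J ≤ 𝔪) {s t : R}
    (hst : 𝔪 ≤ J ⊔ Ideal.span {s, t}) (hs : s ∈ 𝔪) (ht : t ∈ 𝔪)
    (hs' : ∀ a ∈ 𝔪, s * a ∈ J) (ht' : ∀ a ∈ 𝔪, t * a ∈ J)
    (hind : ∀ a b, s * a + t * b ∈ J → a ∈ 𝔪 ∧ b ∈ 𝔪) (hf : Function.Surjective f) :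
    kdim k R (LinearMap.ker f ⧸ (𝔪 • ⊤ : Submodule R (LinearMap.ker f))) +
      2 * (n * kdim k R (R ⧸ 𝔪)) + kdim k R (M ⧸ (J • ⊤ : Submodule R M)) =
      n * kdim k R (R ⧸ J) + 2 * kdim k R (M ⧸ (𝔪 • ⊤ : Submodule R M)) := by
  have h1 := kdim_ker_J (k := k) f hf hJ hfin
  set K := LinearMap.ker f
  have hfin' : KFinite k R (R ⧸ 𝔪) :=
    hfin.of_surjective (α := Submodule.factor hJm) (Submodule.factor_surjective hJm)
  have fFJ : KFinite k R ((Fin n → R) ⧸ (J • ⊤ : Submodule R (Fin n → R))) :=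
    (hfin.pi n).of_injective (α := (piQuotEquiv J).toLinearMap) (piQuotEquiv J).injective
  have fFm : KFinite k R ((Fin n → R) ⧸ (𝔪 • ⊤ : Submodule R (Fin n → R))) :=
    (hfin'.pi n).of_injective (α := (piQuotEquiv 𝔪).toLinearMap) (piQuotEquiv 𝔪).injective
  have fKJ : KFinite k R (K ⧸ (J • ⊤ : Submodule R K)) := by
    refine fFJ.of_injective (α := quotIncl J K.subtype) ?_
    rw [← LinearMap.ker_eq_bot, LinearMap.ker_eq_bot']
    intro x
    obtain ⟨x, rfl⟩ := Submodule.mkQ_surjective _ x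
    intro h
    exact (Submodule.Quotient.mk_eq_zero _).mpr ((mem_smul_top_ker f hJ hf x).mpr
      ((Submodule.Quotient.mk_eq_zero _).mp h))
  let θ : K →ₗ[R] ((Fin n → R) ⧸ (𝔪 • ⊤ : Submodule R (Fin n → R))) := Submodule.mkQ _ ∘ₗ K.subtype
  let ψ : K × K →ₗ[R] (K ⧸ (J • ⊤ : Submodule R K)) :=
    (s • Submodule.mkQ _) ∘ₗ LinearMap.fst R K K + (t • Submodule.mkQ _) ∘ₗ LinearMap.snd R K K
  have hker : LinearMap.ker ψ = LinearMap.ker (θ.prodMap θ) := by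
    ext ⟨a, b⟩
    have e1 : ψ (a, b) = Submodule.mkQ _ (s • a + t • b) := rfl
    have e2 : θ.prodMap θ (a, b) = (Submodule.mkQ _ a.1, Submodule.mkQ _ b.1) := rfl
    rw [LinearMap.mem_ker, LinearMap.mem_ker, e1, e2, Prod.mk_eq_zero, Submodule.mkQ_apply,
      Submodule.mkQ_apply, Submodule.mkQ_apply, Submodule.Quotient.mk_eq_zero,
      Submodule.Quotient.mk_eq_zero, Submodule.Quotient.mk_eq_zero, mem_smul_top_ker f hJ hf,
      mem_smul_top_pi, mem_smul_top_pi, mem_smul_top_pi]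
    constructor
    · intro h
      exact ⟨fun i => (hind _ _ (h i)).1, fun i => (hind _ _ (h i)).2⟩
    · rintro ⟨ha, hb⟩ i
      exact J.add_mem (hs' _ (ha i)) (ht' _ (hb i))
  have eψ : kdim k R (LinearMap.range ψ) = 2 * kdim k R (LinearMap.range θ) := by
    rw [← kdim_prod_self (fFm.of_injective (α := (LinearMap.range θ).subtype)
      Subtype.val_injective)]
    refine kdim_congr k ?_
    refine ψ.quotKerEquivRange.symm ≪≫ₗ Submodule.quotEquivOfEq _ _ hker ≪≫ₗ
      (θ.prodMap θ).quotKerEquivRange ≪≫ₗ LinearEquiv.ofEq _ _ (LinearMap.range_prodMap _ _) ≪≫ₗ ?_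
    exact
      { toFun := fun x => (⟨x.1.1, x.2.1⟩, ⟨x.1.2, x.2.2⟩)
        invFun := fun x => ⟨(x.1, x.2), x.1.2, x.2.2⟩
        map_add' := fun _ _ => rfl
        map_smul' := fun _ _ => rfl
        left_inv := fun _ => rfl
        right_inv := fun _ => rfl }
  have e2 : kdim k R (K ⧸ (J • ⊤ : Submodule R K)) =
      kdim k R (LinearMap.range ψ) + kdim k R (K ⧸ (𝔪 • ⊤ : Submodule R K)) := by
    refine kdim_eq_add_of_exact k (α := (LinearMap.range ψ).subtype)
      (β := Submodule.factor (Submodule.smul_mono_left hJm)) Subtype.val_injective ?_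
      (Submodule.factor_surjective _) fKJ
    intro y
    obtain ⟨y, rfl⟩ := Submodule.mkQ_surjective _ y
    change Submodule.Quotient.mk y = 0 ↔ _
    rw [Submodule.Quotient.mk_eq_zero]
    constructor
    · intro h
      have h := Submodule.smul_mono_left hst h
      suffices Submodule.mkQ _ y ∈ LinearMap.range ψ from ⟨⟨_, this⟩, rfl⟩
      rw [Submodule.sup_smul] at h
      obtain ⟨u, hu, v, hv, rfl⟩ := Submodule.mem_sup.mp h
      rw [map_add, show Submodule.mkQ (J • ⊤ : Submodule R K) u = 0 from
        (Submodule.Quotient.mk_eq_zero _).mpr hu, zero_add]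
      rw [Ideal.span_insert, Submodule.sup_smul] at hv
      obtain ⟨a, ha, b, hb, rfl⟩ := Submodule.mem_sup.mp hv
      rw [Submodule.ideal_span_singleton_smul] at ha hb
      obtain ⟨a, -, rfl⟩ := ha
      obtain ⟨b, -, rfl⟩ := hb
      exact ⟨(a, b), rfl⟩
    · rintro ⟨⟨_, ⟨a, b⟩, rfl⟩, h⟩
      have h : Submodule.mkQ _ (s • a + t • b) = Submodule.mkQ _ y := h
      have h := Submodule.smul_mono_left hJm ((Submodule.Quotient.eq _).mp h)
      have h2 : s • a + t • b ∈ (𝔪 • ⊤ : Submodule R K) :=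
        add_mem (Submodule.smul_mem_smul hs trivial) (Submodule.smul_mem_smul ht trivial)
      simpa using sub_mem h2 h
  have e3 : kdim k R ((Fin n → R) ⧸ (𝔪 • ⊤ : Submodule R (Fin n → R))) =
      kdim k R (LinearMap.range θ) + kdim k R (M ⧸ (𝔪 • ⊤ : Submodule R M)) := by
    refine kdim_eq_add_of_exact k (α := (LinearMap.range θ).subtype)
      (β := quotIncl 𝔪 f) Subtype.val_injective ?_ (quotIncl_surjective f 𝔪 hf) fFm
    intro y
    rw [quotIncl_exact f 𝔪 hf y]
    constructor
    · rintro ⟨x, rfl⟩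
      obtain ⟨x, rfl⟩ := Submodule.mkQ_surjective _ x
      exact ⟨⟨_, x, rfl⟩, rfl⟩
    · rintro ⟨⟨_, x, rfl⟩, rfl⟩
      exact ⟨Submodule.mkQ _ x, rfl⟩
  rw [kdim_congr k (piQuotEquiv 𝔪), kdim_pi hfin'] at e3
  omega

end syzygy

section tor

variable {k A R : Type} [Field k] [CommRing A] [CommRing R] [Algebra k R] [Algebra A R]
  {𝔫 : Ideal A} {𝔪 J : Ideal R}

lemma kfinite_quot {X : Type} [AddCommGroup X] [Module R X] [Module.Finite R X]
    (h : KFinite k R (R ⧸ 𝔪)) : KFinite k R (X ⧸ (𝔪 • ⊤ : Submodule R X)) := by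
  obtain ⟨n, f, hf⟩ := Module.Finite.exists_fin' R X
  exact ((h.pi n).of_injective (α := (piQuotEquiv 𝔪).toLinearMap)
    (piQuotEquiv 𝔪).injective).of_surjective (quotIncl_surjective f 𝔪 hf)

lemma kdim_add_kdim_of_exact {T X Y Z : Type} [AddCommGroup T] [Module R T] [AddCommGroup X]
    [Module R X] [AddCommGroup Y] [Module R Y] [AddCommGroup Z] [Module R Z]
    {α : T →ₗ[R] X} {β : X →ₗ[R] Y} {γ : Y →ₗ[R] Z} (hα : Function.Injective α)
    (hαβ : Function.Exact α β) (hβγ : Function.Exact β γ) (hγ : Function.Surjective γ)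
    (hX : KFinite k R X) (hY : KFinite k R Y) :
    kdim k R T + kdim k R Y = kdim k R X + kdim k R Z := by
  have h1 := kdim_eq_add_of_exact k (α := α) (β := β.rangeRestrict) hα
    (fun x => by rw [← hαβ x, ← Subtype.coe_inj]; rfl) β.surjective_rangeRestrict hX
  have h2 := kdim_eq_add_of_exact k (α := (LinearMap.range β).subtype) (β := γ)
    Subtype.val_injective (fun x => by rw [hβγ x]; simp) hγ hY
  omega

/-- The short complex `0 → ker f → Rⁿ → M → 0`. -/
def kerComplex {M : Type} [AddCommGroup M] [Module R M] {n : ℕ} (f : (Fin n → R) →ₗ[R] M) :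
    ShortComplex (ModuleCat R) where
  X₁ := ModuleCat.of R (LinearMap.ker f)
  X₂ := ModuleCat.of R (Fin n → R)
  X₃ := ModuleCat.of R M
  f := ModuleCat.ofHom (LinearMap.ker f).subtype
  g := ModuleCat.ofHom f
  zero := by
    ext1
    exact LinearMap.ext fun x => x.2

lemma kerComplex_shortExact {M : Type} [AddCommGroup M] [Module R M] {n : ℕ}
    {f : (Fin n → R) →ₗ[R] M} (hf : Function.Surjective f) : (kerComplex f).ShortExact where
  exact := (ShortComplex.ShortExact.moduleCat_exact_iff_function_exact _).mpr
    (LinearMap.exact_subtype_ker_map f)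
  mono_f := (ModuleCat.mono_iff_injective _).mpr Subtype.val_injective
  epi_g := (ModuleCat.epi_iff_surjective _).mpr hf

lemma kdim_tor_one {M : Type} [AddCommGroup M] [Module R M] {n : ℕ}
    {f : (Fin n → R) →ₗ[R] M} (hf : Function.Surjective f) [IsNoetherianRing R]
    (h : KFinite k R (R ⧸ 𝔪)) :
    kdim k R (((Tor (ModuleCat R) 1).obj (ModuleCat.of R M)).obj (ModuleCat.of R (R ⧸ 𝔪))) +
      n * kdim k R (R ⧸ 𝔪) =
      kdim k R (LinearMap.ker f ⧸ (𝔪 • ⊤ : Submodule R (LinearMap.ker f))) +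
        kdim k R (M ⧸ (𝔪 • ⊤ : Submodule R M)) := by
  have : Module.Flat R (kerComplex f).X₂ := inferInstanceAs (Module.Flat R (Fin n → R))
  obtain ⟨X, Y, Z, α, β, γ, hα, hαβ, hβγ, hγ, ⟨eX⟩, ⟨eY⟩, ⟨eZ⟩⟩ :=
    tor_one (kerComplex_shortExact hf) (ModuleCat.of R (R ⧸ 𝔪))
  have eX : X ≃ₗ[R] _ := eX.toLinearEquiv ≪≫ₗ
    TensorProduct.tensorQuotEquivQuotSMul (LinearMap.ker f) 𝔪
  have eY : Y ≃ₗ[R] _ := eY.toLinearEquiv ≪≫ₗ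
    TensorProduct.tensorQuotEquivQuotSMul (Fin n → R) 𝔪
  have eZ : Z ≃ₗ[R] _ := eZ.toLinearEquiv ≪≫ₗ TensorProduct.tensorQuotEquivQuotSMul M 𝔪
  have := kdim_add_kdim_of_exact (k := k) (α := α.hom) (β := β.hom) (γ := γ.hom) hα hαβ hβγ hγ
    ((kfinite_quot h).of_injective (α := eX.toLinearMap) eX.injective)
    ((kfinite_quot h).of_injective (α := eY.toLinearMap) eY.injective)
  rw [kdim_congr k eX, kdim_congr k eY, kdim_congr k eZ, kdim_congr k (piQuotEquiv 𝔪),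
    kdim_pi h] at this
  exact this

/-- Betti numbers of maximal Cohen–Macaulay modules over a ring of minimal multiplicity `3` and
codimension `2`. -/
theorem kdim_tor_succ [IsNoetherianRing R] [Module.Projective A R]
    (hJ : J = 𝔫.map (algebraMap A R)) (hJ3 : kdim k R (R ⧸ J) = 3) (hm1 : kdim k R (R ⧸ 𝔪) = 1)
    (hfin : KFinite k R (R ⧸ J)) (hJm : J ≤ 𝔪) {s t : R}
    (hst : 𝔪 ≤ J ⊔ Ideal.span {s, t}) (hs : s ∈ 𝔪) (ht : t ∈ 𝔪)
    (hs' : ∀ a ∈ 𝔪, s * a ∈ J) (ht' : ∀ a ∈ 𝔪, t * a ∈ J)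
    (hind : ∀ a b, s * a + t * b ∈ J → a ∈ 𝔪 ∧ b ∈ 𝔪) (i : ℕ)
    (M : Type) [AddCommGroup M] [Module R M] [Module A M] [IsScalarTower A R M]
    [Module.Finite R M] [Module.Projective A M] :
    kdim k R (((Tor (ModuleCat R) (i + 1)).obj (ModuleCat.of R M)).obj
        (ModuleCat.of R (R ⧸ 𝔪))) + 2 ^ i * kdim k R (M ⧸ (J • ⊤ : Submodule R M)) =
      2 ^ i * (3 * kdim k R (M ⧸ (𝔪 • ⊤ : Submodule R M))) := by
  have hfin' : KFinite k R (R ⧸ 𝔪) :=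
    hfin.of_surjective (α := Submodule.factor hJm) (Submodule.factor_surjective hJm)
  induction i generalizing M with
  | zero =>
    obtain ⟨n, f, hf⟩ := Module.Finite.exists_fin' R M
    have h1 := kdim_ker_m (k := k) f hJ hfin hJm hst hs ht hs' ht' hind hf
    have h2 := kdim_tor_one (k := k) hf hfin'
    rw [hm1] at h1 h2
    rw [hJ3] at h1
    change kdim k R (((Tor (ModuleCat R) 1).obj (ModuleCat.of R M)).obj
      (ModuleCat.of R (R ⧸ 𝔪))) + _ = _
    simp only [pow_zero, one_mul]
    omega
  | succ i ih =>
    obtain ⟨n, f, hf⟩ := Module.Finite.exists_fin' R M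
    have h1 := kdim_ker_m (k := k) f hJ hfin hJm hst hs ht hs' ht' hind hf
    have h2 := kdim_ker_J (k := k) f hf hJ hfin
    rw [hm1] at h1
    rw [hJ3] at h1 h2
    have : Module.Projective A (LinearMap.ker f) := projective_ker f hf
    have h3 := ih (LinearMap.ker f)
    have : Module.Flat R (kerComplex f).X₂ := inferInstanceAs (Module.Flat R (Fin n → R))
    obtain ⟨e⟩ := tor_add_two (kerComplex_shortExact hf) (ModuleCat.of R (R ⧸ 𝔪)) i
    have h4 := kdim_congr k e.toLinearEquiv
    change kdim k R (((Tor (ModuleCat R) (i + 1 + 1)).obj (ModuleCat.of R M)).obj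
      (ModuleCat.of R (R ⧸ 𝔪))) = kdim k R (((Tor (ModuleCat R) (i + 1)).obj
      (ModuleCat.of R (LinearMap.ker f))).obj (ModuleCat.of R (R ⧸ 𝔪))) at h4
    rw [h4, pow_succ]
    generalize kdim k R (LinearMap.ker f ⧸ (𝔪 • ⊤ : Submodule R (LinearMap.ker f))) = a at *
    generalize kdim k R (LinearMap.ker f ⧸ (J • ⊤ : Submodule R (LinearMap.ker f))) = b at *
    zify at *
    linear_combination h3 + 2 ^ i * (3 * h1 - h2)

end tor

section basis

variable {k A R : Type} [Field k] [CommRing A] [CommRing R] [Algebra k A] [Algebra k R]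
  [Algebra A R] [IsScalarTower k A R] {𝔫 : Ideal A} {J : Ideal R}
  {M : Type} [AddCommGroup M] [Module R M] [Module A M] [IsScalarTower A R M]

/-- For an `A`-module `M` with a finite basis, `M ⧸ JM` is a finite free `A ⧸ 𝔫`-module. -/
def quotEquivOfBasis (hJ : J = 𝔫.map (algebraMap A R)) {m : ℕ} (b : Module.Basis (Fin m) A M) :
    (M ⧸ (J • ⊤ : Submodule R M)) ≃ₗ[A] (Fin m → A ⧸ 𝔫) :=
  (Submodule.Quotient.restrictScalarsEquiv A (J • ⊤ : Submodule R M)).symm ≪≫ₗ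
    Submodule.quotEquivOfEq _ _ (map_smul_top_eq hJ) ≪≫ₗ
    Submodule.Quotient.equiv _ (𝔫 • ⊤ : Submodule A (Fin m → A)) b.equivFun (by
      rw [Submodule.map_smul'', Submodule.map_top, LinearEquiv.range]) ≪≫ₗ piQuotEquiv 𝔫

lemma quotEquivOfBasis_mk (hJ : J = 𝔫.map (algebraMap A R)) {m : ℕ} (b : Module.Basis (Fin m) A M)
    (x : M) (i : Fin m) :
    quotEquivOfBasis hJ b (Submodule.Quotient.mk x) i = Ideal.Quotient.mk 𝔫 (b.repr x i) :=
  rfl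

lemma kdim_quot_of_basis (hJ : J = 𝔫.map (algebraMap A R)) (hn : kdim k A (A ⧸ 𝔫) = 1) {m : ℕ}
    (b : Module.Basis (Fin m) A M) :
    kdim k R (M ⧸ (J • ⊤ : Submodule R M)) = m ∧ KFinite k R (M ⧸ (J • ⊤ : Submodule R M)) := by
  let := Module.compHom (M ⧸ (J • ⊤ : Submodule R M)) (algebraMap k R)
  have := isScalarTower_compHom k (R := R) (X := M ⧸ (J • ⊤ : Submodule R M))
  have : IsScalarTower k A (M ⧸ (J • ⊤ : Submodule R M)) := by
    refine IsScalarTower.of_algebraMap_smul fun c x => ?_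
    rw [← algebraMap_smul R (algebraMap k A c), ← IsScalarTower.algebraMap_apply,
      algebraMap_smul]
  have hf : KFinite k A (A ⧸ 𝔫) := by
    rw [kfinite_iff]
    rw [kdim_eq_finrank] at hn
    exact Module.finite_of_finrank_eq_succ hn
  have h1 := kdim_congr k (quotEquivOfBasis hJ b)
  rw [kdim_pi hf, hn, mul_one, kdim_eq_finrank] at h1
  refine ⟨by rw [kdim_eq_finrank, h1], ?_⟩
  have h2 := (hf.pi m).of_injective (α := (quotEquivOfBasis hJ b).toLinearMap)
    (quotEquivOfBasis hJ b).injective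
  rw [kfinite_iff] at h2 ⊢
  exact h2

lemma repr_mem_of_mem (hJ : J = 𝔫.map (algebraMap A R)) {m : ℕ} (b : Module.Basis (Fin m) A R)
    {x : R} (hx : x ∈ J) (i : Fin m) : b.repr x i ∈ 𝔫 := by
  have h : x ∈ (J • ⊤ : Submodule R R) := by simpa using hx
  rw [← Submodule.Quotient.mk_eq_zero] at h
  rw [← Ideal.Quotient.eq_zero_iff_mem, ← quotEquivOfBasis_mk hJ b, h, map_zero, Pi.zero_apply]

end basis

lemma kdim_quot_ker {k R : Type} [Field k] [CommRing R] [Algebra k R] (f : R →ₐ[k] k) :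
    kdim k R (R ⧸ RingHom.ker f) = 1 := by
  have hf : Function.Surjective f := fun c => ⟨algebraMap k R c, by simp⟩
  rw [kdim_eq_finrank, ← Module.finrank_self k]
  exact (Ideal.quotientKerAlgEquivOfSurjective hf).toLinearEquiv.finrank_eq

lemma kdim_quot_eq_card {k R M E : Type} [Field k] [CommRing R] [Algebra k R] [AddCommGroup M]
    [Module R M] [Fintype E] (N : Submodule R M) (θ : M →+ (E → k))
    (hsmul : ∀ (c : k) (m : M), θ (algebraMap k R c • m) = c • θ m)
    (hsurj : Function.Surjective θ) (hker : ∀ m, θ m = 0 ↔ m ∈ N) :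
    kdim k R (M ⧸ N) = Fintype.card E := by
  let := Module.compHom M (algebraMap k R)
  have := isScalarTower_compHom k (R := R) (X := M)
  let f : M →ₗ[k] (E → k) := { θ with map_smul' := fun c m => hsmul c m }
  have hN : N.restrictScalars k = LinearMap.ker f := by
    ext m
    exact (hker m).symm
  rw [kdim_eq_finrank, ← Module.finrank_fintype_fun_eq_card k]
  exact ((Submodule.Quotient.restrictScalarsEquiv k N).symm ≪≫ₗ
    Submodule.quotEquivOfEq _ _ hN ≪≫ₗ f.quotKerEquivOfSurjective hsurj).finrank_eq

end TorShift

namespace Scroll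

open TorShift

section noether

variable (k : Type) [Field k]

/-- The polynomial ring in three variables, as the coordinate ring of the Noether normalization
`k[x², yz, y² - xz]` of `R`. -/
abbrev NoeRing : Type := MvPolynomial (Option (Fin 2)) k

/-- The inclusion of the Noether normalization `k[x², yz, y² - xz]` into `k[x, y, z]`. -/
def phiS : NoeRing k →ₐ[k] MvPolynomial (Fin 3) k :=
  aeval fun i => i.elim (X 0 ^ 2) ![X 1 * X 2, X 1 ^ 2 - X 0 * X 2]

/-- The Noether normalization `k[x², yz, y² - xz]` of `R`. -/
def phi : NoeRing k →ₐ[k] Rscr k :=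
  aeval fun i => i.elim (gx2 k) ![gyz k, gy2 k - gxz k]

variable {k}

lemma coe_phi (P : NoeRing k) : (phi k P : MvPolynomial (Fin 3) k) = phiS k P := by
  have : (Rscr k).val.comp (phi k) = phiS k := by
    ext i : 1
    rcases i with _ | i
    · simp [phi, phiS, gx2]
    · fin_cases i <;> simp [phi, phiS, gyz, gy2, gxz]
  exact DFunLike.congr_fun this P

lemma exists_eq_of_mem {f : MvPolynomial (Fin 3) k} (hf : f ∈ Rscr k) :
    ∃ P Q T : NoeRing k,
      f = phiS k P + phiS k Q * (X 0 * X 1) + phiS k T * (X 0 * X 2) := by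
  have h0 : phiS k (X none) = X 0 ^ 2 := by simp [phiS]
  have h1 : phiS k (X (some 0)) = X 1 * X 2 := by simp [phiS]
  have h2 : phiS k (X (some 1)) = X 1 ^ 2 - X 0 * X 2 := by simp [phiS]
  induction hf using Algebra.adjoin_induction with
  | mem f hf =>
    rcases hf with rfl | rfl | rfl | rfl | rfl
    · exact ⟨X none, 0, 0, by simp [h0]⟩
    · exact ⟨0, 1, 0, by simp⟩
    · exact ⟨X (some 1), 0, 1, by simp [h2]⟩
    · exact ⟨0, 0, 1, by simp⟩
    · exact ⟨X (some 0), 0, 0, by simp [h1]⟩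
  | algebraMap c => exact ⟨algebraMap _ _ c, 0, 0, by simp⟩
  | add f g _ _ hf hg =>
    obtain ⟨P, Q, T, rfl⟩ := hf
    obtain ⟨P', Q', T', rfl⟩ := hg
    exact ⟨P + P', Q + Q', T + T', by simp only [map_add]; ring⟩
  | mul f g _ _ hf hg =>
    obtain ⟨P, Q, T, rfl⟩ := hf
    obtain ⟨P', Q', T', rfl⟩ := hg
    refine ⟨P * P' + Q * Q' * (X none * X (some 1)) + (Q * T' + T * Q') * (X none * X (some 0)),
      P * Q' + Q * P' + T * T' * X (some 0),
      P * T' + T * P' + Q * Q' * X none - T * T' * X (some 1), ?_⟩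
    simp only [map_add, map_mul, map_sub, h0, h1, h2]
    ring

section independence

lemma eq_zero_of_add_add_eq_zero {K : Type} [Field K] {f g h : Polynomial K} (e : f + g + h = 0)
    (hfg : f ≠ 0 → g ≠ 0 → f.degree ≠ g.degree) (hfh : f ≠ 0 → h ≠ 0 → f.degree ≠ h.degree)
    (hgh : g ≠ 0 → h ≠ 0 → g.degree ≠ h.degree) : f = 0 ∧ g = 0 ∧ h = 0 := by
  have e' : f = -(g + h) := by linear_combination e
  have hd : f.degree = (g + h).degree := by rw [e', Polynomial.degree_neg]
  by_cases hg : g = 0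
  · subst hg
    by_cases hh : h = 0
    · simp_all
    · have hf : f ≠ 0 := fun hf => hh (by simpa [hf] using e)
      exact absurd (by simpa using hd) (hfh hf hh)
  by_cases hh : h = 0
  · subst hh
    have hf : f ≠ 0 := fun hf => hg (by simpa [hf] using e)
    exact absurd (by simpa using hd) (hfg hf hg)
  have hf : f ≠ 0 := by
    rintro rfl
    refine hgh hg hh ?_
    rw [show g = -h by linear_combination e, Polynomial.degree_neg]
  rcases lt_or_gt_of_ne (hgh hg hh) with hl | hl
  · exact absurd (hd.trans (Polynomial.degree_add_eq_right_of_degree_lt hl)) (hfh hf hh)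
  · exact absurd (hd.trans (Polynomial.degree_add_eq_left_of_degree_lt hl)) (hfg hf hg)

variable (k)

/-- The function field in two variables. -/
abbrev FF : Type := FractionRing (MvPolynomial (Fin 2) k)

/-- The first variable of the function field. -/
def vv : FF k := algebraMap (MvPolynomial (Fin 2) k) (FF k) (X 0)

/-- The second variable of the function field. -/
def ww : FF k := algebraMap (MvPolynomial (Fin 2) k) (FF k) (X 1)

lemma vv_ne_zero : vv k ≠ 0 := by
  simp [vv]

/-- `x` as a polynomial in `y` over `k(v, w)`. -/
def xPoly : Polynomial (FF k) :=
  Polynomial.C (vv k)⁻¹ *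
    (Polynomial.X ^ 3 - Polynomial.C (ww k) * Polynomial.X)

/-- `phi` followed by the embedding of `R` into `k(v, w)[y]`. -/
def gam : NoeRing k →ₐ[k] Polynomial (FF k) :=
  aeval fun i => i.elim (xPoly k ^ 2) ![Polynomial.C (vv k), Polynomial.C (ww k)]

/-- The Noether normalization as polynomials in the first variable over the function field of the
other two. -/
def bet (P : NoeRing k) : Polynomial (FF k) :=
  (optionEquivLeft k (Fin 2) P).map (algebraMap _ (FF k))

lemma bet_injective : Function.Injective (bet k) :=
  (Polynomial.map_injective _ (IsFractionRing.injective _ _)).comp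
    (optionEquivLeft k (Fin 2)).injective

lemma gam_eq (P : NoeRing k) : gam k P = (bet k P).comp (xPoly k ^ 2) := by
  induction P using MvPolynomial.induction_on with
  | C a =>
    simp [gam, bet, optionEquivLeft_C, Polynomial.algebraMap_apply, MvPolynomial.algebraMap_eq,
      IsScalarTower.algebraMap_apply k (MvPolynomial (Fin 2) k) (FF k)]
  | add p q hp hq => simp [hp, hq, bet] at *
  | mul_X p i hp =>
    have : bet k (p * X i) = bet k p * bet k (X i) := by simp [bet]
    rw [map_mul, hp, this, Polynomial.mul_comp]
    congr 1
    rcases i with _ | i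
    · simp [gam, bet, optionEquivLeft_X_none]
    · fin_cases i <;> simp [gam, bet, optionEquivLeft_X_some, vv, ww]

/-- The specialization `x ↦ (y³ - w y) / v`, `z ↦ v / y`. -/
def psi : MvPolynomial (Fin 3) k →ₐ[k] FractionRing (Polynomial (FF k)) :=
  aeval ![algebraMap _ _ (xPoly k), algebraMap (Polynomial (FF k)) _ Polynomial.X,
    algebraMap _ _ (Polynomial.C (vv k)) /
      algebraMap (Polynomial (FF k)) _ Polynomial.X]

lemma psi_xz : psi k (X 0 * X 2) = algebraMap (Polynomial (FF k)) _
    (Polynomial.X ^ 2 - Polynomial.C (ww k)) := by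
  have h1 : algebraMap (Polynomial (FF k)) (FractionRing (Polynomial (FF k))) Polynomial.X ≠ 0 := by
    simp
  have h2 : (vv k) ≠ 0 := vv_ne_zero k
  simp only [psi, map_mul, aeval_X, Matrix.cons_val]
  rw [mul_div_assoc', div_eq_iff h1, ← map_mul, ← map_mul]
  congr 1
  have : Polynomial.C (vv k)⁻¹ * Polynomial.C (vv k) = 1 := by
    rw [← Polynomial.C_mul, inv_mul_cancel₀ h2, Polynomial.C_1]
  rw [xPoly]
  linear_combination (Polynomial.X ^ 3 - Polynomial.C (ww k) * Polynomial.X) * this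

lemma psi_phiS (P : NoeRing k) :
    psi k (phiS k P) = algebraMap _ _ (gam k P) := by
  have : (psi k).comp (phiS k) =
      (IsScalarTower.toAlgHom k (Polynomial (FF k)) (FractionRing (Polynomial (FF k)))).comp
        (gam k) := by
    ext i : 1
    rcases i with _ | i
    · simp [phiS, gam, psi]
    fin_cases i
    · have h1 : algebraMap (Polynomial (FF k)) (FractionRing (Polynomial (FF k)))
          Polynomial.X ≠ 0 := by
        simp
      simp [phiS, gam, psi]
      field_simp
    · have := psi_xz k
      simp [phiS, gam] at *
      rw [this]
      simp [psi]
  exact DFunLike.congr_fun this P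

lemma natDegree_xPoly : (xPoly k).natDegree = 3 := by
  have h2 : (vv k) ≠ 0 := vv_ne_zero k
  rw [xPoly, Polynomial.natDegree_C_mul (inv_ne_zero h2)]
  compute_degree!

variable {k}

lemma eq_zero_of_phiS {P Q T : NoeRing k}
    (h : phiS k P + phiS k Q * (X 0 * X 1) + phiS k T * (X 0 * X 2) = 0) :
    P = 0 ∧ Q = 0 ∧ T = 0 := by
  have h1 := congrArg (psi k) h
  have hxy : psi k (X 0 * X 1) = algebraMap _ _ (xPoly k * Polynomial.X) := by simp [psi]
  simp only [map_add, map_mul (psi k) (phiS k _), psi_phiS, psi_xz, hxy, map_zero] at h1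
  simp only [← map_mul, ← map_add] at h1
  rw [map_eq_zero_iff _ (IsFractionRing.injective _ _)] at h1
  simp only [gam_eq] at h1
  have hb (P) (hP : bet k P = 0) : P = 0 := bet_injective k (by rw [hP]; simp [bet])
  suffices bet k P = 0 ∧ bet k Q = 0 ∧ bet k T = 0 from
    ⟨hb _ this.1, hb _ this.2.1, hb _ this.2.2⟩
  generalize bet k P = a at *
  generalize bet k Q = b at *
  generalize bet k T = c at *
  have hx0 : xPoly k ≠ 0 := fun h => by have := natDegree_xPoly k; simp [h] at this
  have hx : (xPoly k ^ 2).natDegree = 6 := by rw [Polynomial.natDegree_pow, natDegree_xPoly]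
  have hw : (Polynomial.X ^ 2 - Polynomial.C (ww k)).natDegree = 2 := by
    compute_degree!
  have hw0 : Polynomial.X ^ 2 - Polynomial.C (ww k) ≠ 0 := fun h => by
    simp [h] at hw
  have hs : (xPoly k * Polynomial.X).natDegree = 4 := by
    rw [Polynomial.natDegree_mul hx0 Polynomial.X_ne_zero, natDegree_xPoly, Polynomial.natDegree_X]
  have hs0 : xPoly k * Polynomial.X ≠ 0 := mul_ne_zero hx0 Polynomial.X_ne_zero
  have hc (a : Polynomial (FF k)) (ha : a ≠ 0) : a.comp (xPoly k ^ 2) ≠ 0 := fun h => by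
    rw [Polynomial.comp_eq_zero_iff] at h
    rcases h with h | h
    · exact ha h
    · rw [h.2] at hx; simp at hx
  have hd (a : Polynomial (FF k)) : (a.comp (xPoly k ^ 2)).natDegree = a.natDegree * 6 := by
    rw [Polynomial.natDegree_comp, hx]
  have da (a : Polynomial (FF k)) (ha : a ≠ 0) :
      (a.comp (xPoly k ^ 2)).degree =
        ((a.natDegree * 6 : ℕ) : WithBot ℕ) := by
    rw [Polynomial.degree_eq_natDegree (hc a ha), hd]
  have db (a : Polynomial (FF k)) (ha : a ≠ 0) :
      (a.comp (xPoly k ^ 2) * (xPoly k * Polynomial.X)).degree =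
        ((a.natDegree * 6 + 4 : ℕ) : WithBot ℕ) := by
    rw [Polynomial.degree_mul, da a ha, Polynomial.degree_eq_natDegree hs0, hs]; simp
  have dc (a : Polynomial (FF k)) (ha : a ≠ 0) :
      (a.comp (xPoly k ^ 2) * (Polynomial.X ^ 2 - Polynomial.C (ww k))).degree =
        ((a.natDegree * 6 + 2 : ℕ) : WithBot ℕ) := by
    rw [Polynomial.degree_mul, da a ha, Polynomial.degree_eq_natDegree hw0, hw]; simp
  have hz (a : Polynomial (FF k)) (ha : a.comp (xPoly k ^ 2) = 0) : a = 0 := by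
    by_contra h
    exact hc a h ha
  have hm (m n r s : ℕ) (hr : r < 6) (hs : s < 6) (hrs : r ≠ s) :
      ((m * 6 + r : ℕ) : WithBot ℕ) ≠ ((n * 6 + s : ℕ) : WithBot ℕ) := by
    rw [Ne, Nat.cast_inj]
    lia
  obtain ⟨ha, hb, hc⟩ := eq_zero_of_add_add_eq_zero h1
    (fun ha hb => by
      rw [da a (by rintro rfl; simp at ha), db b (by rintro rfl; simp at hb)]
      exact hm _ _ 0 4 (by simp) (by simp) (by simp))
    (fun ha hb => by
      rw [da a (by rintro rfl; simp at ha), dc c (by rintro rfl; simp at hb)]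
      exact hm _ _ 0 2 (by simp) (by simp) (by simp))
    (fun ha hb => by
      rw [db b (by rintro rfl; simp at ha), dc c (by rintro rfl; simp at hb)]
      exact hm _ _ 4 2 (by simp) (by simp) (by simp))
  exact ⟨hz a ha, hz b ((mul_eq_zero_iff_right hs0).mp hb),
    hz c ((mul_eq_zero_iff_right hw0).mp hc)⟩

end independence

end noether

section parameters

variable {k : Type} [Field k]

instance algebraNoether : Algebra (NoeRing k) (Rscr k) := (phi k).toRingHom.toAlgebra

lemma algebraMap_eq_phi (P : NoeRing k) :
    algebraMap (NoeRing k) (Rscr k) P = phi k P := rfl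

instance isScalarTower_noether : IsScalarTower k (NoeRing k) (Rscr k) :=
  .of_algebraMap_eq fun c => by rw [algebraMap_eq_phi, AlgHom.commutes]

lemma coe_smul_noether (P : NoeRing k) (r : Rscr k) :
    ((P • r : Rscr k) : MvPolynomial (Fin 3) k) = phiS k P * r := by
  rw [Algebra.smul_def, algebraMap_eq_phi, Subalgebra.coe_mul, coe_phi]

variable (k)

/-- The basis `1, xy, xz` of `R` over its Noether normalization. -/
def basisNoether : Module.Basis (Fin 3) (NoeRing k) (Rscr k) :=
  .mk (v := ![1, gxy k, gxz k])
    (by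
      rw [Fintype.linearIndependent_iff]
      intro g hg
      have h := congrArg (Subtype.val) hg
      simp only [Fin.sum_univ_three, Matrix.cons_val, Subalgebra.coe_add, coe_smul_noether,
        Subalgebra.coe_one, mul_one, gxy, gxz, Subalgebra.coe_zero] at h
      obtain ⟨h0, h1, h2⟩ := eq_zero_of_phiS h
      intro i
      fin_cases i <;> assumption)
    (by
      rintro ⟨f, hf⟩ -
      obtain ⟨P, Q, T, rfl⟩ := exists_eq_of_mem hf
      rw [Submodule.mem_span_range_iff_exists_fun]
      refine ⟨![P, Q, T], Subtype.ext ?_⟩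
      simp only [Fin.sum_univ_three, Matrix.cons_val, Subalgebra.coe_add, coe_smul_noether,
        Subalgebra.coe_one, mul_one, gxy, gxz])

instance finite_noether : Module.Finite (NoeRing k) (Rscr k) :=
  .of_basis (basisNoether k)

instance free_noether : Module.Free (NoeRing k) (Rscr k) :=
  .of_basis (basisNoether k)

instance isNoetherianRing_Rscr : IsNoetherianRing (Rscr k) :=
  .of_finite (NoeRing k) (Rscr k)

/-- The irrelevant ideal of the polynomial ring. -/
def irr : Ideal (NoeRing k) := Ideal.span (Set.range X)

/-- The parameter ideal `(x², yz, y² - xz)` of `R`. -/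
def parIdeal : Ideal (Rscr k) := Ideal.map (algebraMap (NoeRing k) (Rscr k)) (irr k)

lemma sub_C_mem_irr (P : NoeRing k) : P - C (aeval (0 : Option (Fin 2) → k) P) ∈ irr k := by
  induction P using MvPolynomial.induction_on with
  | C a => simp
  | add p q hp hq =>
    have := add_mem hp hq
    rw [map_add, C_add]
    convert this using 1
    ring
  | mul_X p i hp =>
    have : X i ∈ irr k := Ideal.subset_span ⟨i, rfl⟩
    simpa using Ideal.mul_mem_left _ p this

lemma mem_irr_iff {P : NoeRing k} : P ∈ irr k ↔ aeval (0 : Option (Fin 2) → k) P = 0 := by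
  constructor
  · intro h
    have : irr k ≤ RingHom.ker (aeval (0 : Option (Fin 2) → k)) := by
      rw [irr, Ideal.span_le]
      rintro _ ⟨i, rfl⟩
      simp
    exact this h
  · intro h
    simpa [h] using sub_C_mem_irr k P

lemma irr_eq_ker : irr k = RingHom.ker (aeval (0 : Option (Fin 2) → k)) := by
  ext P
  rw [mem_irr_iff, RingHom.mem_ker]

lemma kdim_irr : kdim k (NoeRing k) (NoeRing k ⧸ (irr k : Ideal (NoeRing k))) = 1 := by
  rw [irr_eq_ker]
  exact kdim_quot_ker (R := NoeRing k) (aeval (0 : Option (Fin 2) → k))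

lemma phi_X : phi k (X none) = gx2 k ∧ phi k (X (some 0)) = gyz k ∧
    phi k (X (some 1)) = gy2 k - gxz k := by
  simp [phi]

lemma phi_mem {P : NoeRing k} (h : P ∈ irr k) : phi k P ∈ parIdeal k :=
  Ideal.mem_map_of_mem _ h

lemma gens_mem_parIdeal : gx2 k ∈ parIdeal k ∧ gyz k ∈ parIdeal k ∧
    gy2 k - gxz k ∈ parIdeal k := by
  obtain ⟨h0, h1, h2⟩ := phi_X k
  rw [← h0, ← h1, ← h2]
  exact ⟨phi_mem k (Ideal.subset_span ⟨_, rfl⟩), phi_mem k (Ideal.subset_span ⟨_, rfl⟩),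
    phi_mem k (Ideal.subset_span ⟨_, rfl⟩)⟩

lemma gens_mem_mScr : gx2 k ∈ mScr k ∧ gxy k ∈ mScr k ∧ gy2 k ∈ mScr k ∧ gxz k ∈ mScr k ∧
    gyz k ∈ mScr k := by
  refine ⟨?_, ?_, ?_, ?_, ?_⟩ <;> exact Ideal.subset_span (by simp)

lemma parIdeal_le : parIdeal k ≤ mScr k := by
  obtain ⟨h1, h2, h3, h4, h5⟩ := gens_mem_mScr k
  obtain ⟨p0, p1, p2⟩ := phi_X k
  rw [parIdeal, irr, Ideal.map_span, Ideal.span_le]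
  rintro _ ⟨_, ⟨i, rfl⟩, rfl⟩
  simp only [algebraMap_eq_phi]
  rcases i with _ | i
  · exact p0 ▸ h1
  fin_cases i
  · exact p1 ▸ h5
  · exact p2 ▸ sub_mem h3 h4

lemma mScr_le : mScr k ≤ parIdeal k ⊔ Ideal.span {gxy k, gxz k} := by
  obtain ⟨p0, p1, p2⟩ := gens_mem_parIdeal k
  have hs : gxy k ∈ parIdeal k ⊔ Ideal.span {gxy k, gxz k} :=
    Ideal.mem_sup_right (Ideal.subset_span (by simp))
  have ht : gxz k ∈ parIdeal k ⊔ Ideal.span {gxy k, gxz k} :=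
    Ideal.mem_sup_right (Ideal.subset_span (by simp))
  rw [mScr, Ideal.span_le]
  rintro _ (rfl | rfl | rfl | rfl | rfl)
  · exact Ideal.mem_sup_left p0
  · exact hs
  · have := add_mem (Ideal.mem_sup_left (T := Ideal.span {gxy k, gxz k}) p2) ht
    rwa [sub_add_cancel] at this
  · exact ht
  · exact Ideal.mem_sup_left p1

lemma gxy_mul_mem {a : Rscr k} (ha : a ∈ mScr k) : gxy k * a ∈ parIdeal k := by
  obtain ⟨p0, p1, p2⟩ := gens_mem_parIdeal k
  induction ha using Submodule.span_induction with
  | mem x hx =>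
    rcases hx with rfl | rfl | rfl | rfl | rfl
    · exact Ideal.mul_mem_left _ _ p0
    · have : gxy k * gxy k = gy2 k * gx2 k := Subtype.ext (by simp [gx2, gxy, gy2]; ring)
      rw [this]
      exact Ideal.mul_mem_left _ _ p0
    · have : gxy k * gy2 k = gxy k * (gy2 k - gxz k) + gx2 k * gyz k :=
        Subtype.ext (by simp [gx2, gxy, gy2, gxz, gyz]; ring)
      rw [this]
      exact add_mem (Ideal.mul_mem_left _ _ p2) (Ideal.mul_mem_left _ _ p1)
    · have : gxy k * gxz k = gx2 k * gyz k := Subtype.ext (by simp [gx2, gxy, gxz, gyz]; ring)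
      rw [this]
      exact Ideal.mul_mem_left _ _ p1
    · exact Ideal.mul_mem_left _ _ p1
  | zero => simp
  | add x y _ _ hx hy => rw [mul_add]; exact add_mem hx hy
  | smul a x _ hx => rw [smul_eq_mul, mul_left_comm]; exact Ideal.mul_mem_left _ _ hx

lemma gxz_mul_mem {a : Rscr k} (ha : a ∈ mScr k) : gxz k * a ∈ parIdeal k := by
  obtain ⟨p0, p1, p2⟩ := gens_mem_parIdeal k
  induction ha using Submodule.span_induction with
  | mem x hx =>
    rcases hx with rfl | rfl | rfl | rfl | rfl
    · exact Ideal.mul_mem_left _ _ p0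
    · have : gxz k * gxy k = gx2 k * gyz k := Subtype.ext (by simp [gx2, gxy, gxz, gyz]; ring)
      rw [this]
      exact Ideal.mul_mem_left _ _ p1
    · have : gxz k * gy2 k = gxy k * gyz k := Subtype.ext (by simp [gy2, gxy, gxz, gyz]; ring)
      rw [this]
      exact Ideal.mul_mem_left _ _ p1
    · have : gxz k * gxz k = gxy k * gyz k - gxz k * (gy2 k - gxz k) :=
        Subtype.ext (by simp [gxy, gy2, gxz, gyz]; ring)
      rw [this]
      exact sub_mem (Ideal.mul_mem_left _ _ p1) (Ideal.mul_mem_left _ _ p2)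
    · exact Ideal.mul_mem_left _ _ p1
  | zero => simp
  | add x y _ _ hx hy => rw [mul_add]; exact add_mem hx hy
  | smul a x _ hx => rw [smul_eq_mul, mul_left_comm]; exact Ideal.mul_mem_left _ _ hx

lemma exists_sub_phi_mem (a : Rscr k) : ∃ P, a - phi k P ∈ mScr k := by
  obtain ⟨P, Q, T, h⟩ := exists_eq_of_mem a.2
  refine ⟨P, ?_⟩
  obtain ⟨_, h2, _, h4, _⟩ := gens_mem_mScr k
  have : a - phi k P = phi k Q * gxy k + phi k T * gxz k := by
    refine Subtype.ext ?_
    simp only [Subalgebra.coe_sub, Subalgebra.coe_add, Subalgebra.coe_mul, coe_phi, h, gxy, gxz]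
    ring
  rw [this]
  exact add_mem (Ideal.mul_mem_left _ _ h2) (Ideal.mul_mem_left _ _ h4)

lemma mem_mScr_of_mul_add_mul_mem (a b : Rscr k) (h : gxy k * a + gxz k * b ∈ parIdeal k) :
    a ∈ mScr k ∧ b ∈ mScr k := by
  obtain ⟨P, hP⟩ := exists_sub_phi_mem k a
  obtain ⟨Q, hQ⟩ := exists_sub_phi_mem k b
  have h1 : (P : NoeRing k) • gxy k + (Q : NoeRing k) • gxz k ∈ parIdeal k := by
    have := sub_mem h (add_mem (gxy_mul_mem k hP) (gxz_mul_mem k hQ))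
    rw [Algebra.smul_def, Algebra.smul_def, algebraMap_eq_phi, algebraMap_eq_phi]
    convert this using 1
    ring
  have h2 : (basisNoether k).repr ((P : NoeRing k) • gxy k + (Q : NoeRing k) • gxz k) =
      (P : NoeRing k) • Finsupp.single 1 1 + (Q : NoeRing k) • Finsupp.single 2 1 := by
    have e1 : gxy k = basisNoether k 1 := by simp [basisNoether]
    have e2 : gxz k = basisNoether k 2 := by simp [basisNoether]
    rw [e1, e2, map_add, map_smul, map_smul, Module.Basis.repr_self, Module.Basis.repr_self]
  have hP' := repr_mem_of_mem (J := parIdeal k) rfl (basisNoether k) h1 1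
  have hQ' := repr_mem_of_mem (J := parIdeal k) rfl (basisNoether k) h1 2
  rw [h2] at hP' hQ'
  simp at hP' hQ'
  constructor
  · simpa using add_mem hP (parIdeal_le k (phi_mem k hP'))
  · simpa using add_mem hQ (parIdeal_le k (phi_mem k hQ'))

/-- The augmentation of `R`. -/
def augR : Rscr k →ₐ[k] k := (aeval (0 : Fin 3 → k)).comp (Rscr k).val

lemma augR_phi (P : NoeRing k) : augR k (phi k P) = aeval (0 : Option (Fin 2) → k) P := by
  have : (augR k).comp (phi k) = aeval (0 : Option (Fin 2) → k) := by
    ext i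
    rcases i with _ | i
    · simp [augR, phi, gx2]
    · fin_cases i <;> simp [augR, phi, gyz, gy2, gxz]
  exact DFunLike.congr_fun this P

lemma mScr_eq_ker : mScr k = RingHom.ker (augR k) := by
  have hle : mScr k ≤ RingHom.ker (augR k) := by
    rw [mScr, Ideal.span_le]
    rintro _ (rfl | rfl | rfl | rfl | rfl) <;> simp [augR, gx2, gyz, gy2, gxz, gxy]
  refine le_antisymm hle fun a ha => ?_
  obtain ⟨P, hP⟩ := exists_sub_phi_mem k a
  have h1 := hle hP
  rw [RingHom.mem_ker] at ha h1
  rw [map_sub, ha, zero_sub, neg_eq_zero, augR_phi, ← mem_irr_iff] at h1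
  simpa using add_mem hP (parIdeal_le k (phi_mem k h1))

lemma kdim_mScr : kdim k (Rscr k) (Rscr k ⧸ mScr k) = 1 := by
  rw [mScr_eq_ker]
  exact kdim_quot_ker (augR k)

lemma kdim_parIdeal : kdim k (Rscr k) (Rscr k ⧸ parIdeal k) = 3 ∧
    KFinite k (Rscr k) (Rscr k ⧸ parIdeal k) := by
  have h := kdim_quot_of_basis (k := k) (J := parIdeal k) rfl (kdim_irr k) (basisNoether k)
  have e : (Rscr k ⧸ (parIdeal k • ⊤ : Submodule (Rscr k) (Rscr k))) ≃ₗ[Rscr k]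
    (Rscr k ⧸ parIdeal k) := Submodule.quotEquivOfEq _ _ (Ideal.mul_top _)
  exact ⟨(kdim_congr k e).symm.trans h.1, h.2.of_surjective (α := e.toLinearMap) e.surjective⟩

end parameters

section frobenius

variable {σ K : Type} [Field K] (p : ℕ) [Fact p.Prime] [CharP K p] (e : ℕ)

lemma coeff_pow_smul (f : MvPolynomial σ K) (n : σ →₀ ℕ) :
    coeff (p ^ e • n) (f ^ p ^ e) = coeff n f ^ p ^ e := by
  rw [← map_iterateFrobenius_expand p, coeff_map, coeff_expand_smul _ (NeZero.ne _),
    iterateFrobenius_def]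

lemma coeff_pow_of_not_dvd (f : MvPolynomial σ K) {n : σ →₀ ℕ} {i : σ} (h : ¬ p ^ e ∣ n i) :
    coeff n (f ^ p ^ e) = 0 := by
  rw [← map_iterateFrobenius_expand p, coeff_map, coeff_expand_of_not_dvd _ h, map_zero]

variable [Finite σ]

/-- The exponent with all entries less than `q` given by a function to `Fin q`. -/
def expOf {q : ℕ} (j : σ → Fin q) : σ →₀ ℕ := Finsupp.equivFunOnFinite.symm fun i => (j i : ℕ)

lemma expOf_apply {q : ℕ} (j : σ → Fin q) (i : σ) : expOf j i = j i := rfl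

lemma coeff_pow_mul_monomial [DecidableEq (σ → Fin (p ^ e))] (f : MvPolynomial σ K) (n : σ →₀ ℕ)
    (j j' : σ → Fin (p ^ e)) :
    coeff (p ^ e • n + expOf j') (f ^ p ^ e * monomial (expOf j) 1) =
      if j = j' then coeff n f ^ p ^ e else 0 := by
  rw [coeff_mul_monomial', mul_one]
  split_ifs with h1 h2 h2
  · rw [h2, add_tsub_cancel_right, coeff_pow_smul]
  · obtain ⟨i, hi⟩ := Function.ne_iff.mp h2
    refine coeff_pow_of_not_dvd p e f (i := i) fun h => hi (Fin.ext ?_)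
    have h3 := h1 i
    simp only [Finsupp.tsub_apply, Finsupp.add_apply, Finsupp.smul_apply, expOf_apply,
      smul_eq_mul] at h h3
    have h4 := (Nat.modEq_iff_dvd' h3).mpr h
    have h5 : (j' i : ℕ) ≡ j i [MOD p ^ e] := by
      simpa [Nat.ModEq] using h4.symm
    exact (h5.eq_of_lt_of_lt (j' i).2 (j i).2).symm
  · exact absurd (h2 ▸ le_add_self) h1
  · rfl

lemma eq_zero_of_sum_pow_mul_monomial [Fintype (σ → Fin (p ^ e))]
    {g : (σ → Fin (p ^ e)) → MvPolynomial σ K}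
    (h : ∑ j, g j ^ p ^ e * monomial (expOf j) 1 = 0) (j) : g j = 0 := by
  classical
  ext n
  have h1 := congrArg (coeff (p ^ e • n + expOf j)) h
  simp only [coeff_sum, coeff_pow_mul_monomial, Finset.sum_ite_eq', Finset.mem_univ, if_true,
    coeff_zero] at h1
  rw [coeff_zero]
  exact pow_eq_zero_iff (NeZero.ne _) |>.mp h1

lemma exists_sum_pow_mul_monomial [PerfectRing K p] [Fintype (σ → Fin (p ^ e))]
    (f : MvPolynomial σ K) :
    ∃ g : (σ → Fin (p ^ e)) → MvPolynomial σ K,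
      ∑ j, g j ^ p ^ e * monomial (expOf j) 1 = f := by
  classical
  induction f using MvPolynomial.induction_on' with
  | monomial n c =>
    have hq : 0 < p ^ e := NeZero.pos _
    let j : σ → Fin (p ^ e) := fun i => ⟨n i % p ^ e, Nat.mod_lt _ hq⟩
    let n' : σ →₀ ℕ := n.mapRange (· / p ^ e) (Nat.zero_div _)
    refine ⟨Pi.single j (monomial n' ((iterateFrobeniusEquiv K p e).symm c)), ?_⟩
    rw [Finset.sum_eq_single j]
    · rw [Pi.single_eq_same, monomial_pow, monomial_mul, mul_one, ← iterateFrobenius_def,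
        ← iterateFrobeniusEquiv_apply, RingEquiv.apply_symm_apply]
      congr 2
      ext i
      simp [n', j, expOf_apply, Nat.div_add_mod]
    · intro b _ hb
      rw [Pi.single_eq_of_ne hb, zero_pow hq.ne', zero_mul]
    · simp
  | add f g hf hg =>
    obtain ⟨a, rfl⟩ := hf
    obtain ⟨b, rfl⟩ := hg
    refine ⟨a + b, ?_⟩
    simp only [Pi.add_apply, add_pow_char_pow, add_mul, Finset.sum_add_distrib]

end frobenius

section frobeniusScroll

variable (k : Type) [Field k] (p : ℕ) [Fact p.Prime] [CharP k p] (e : ℕ)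

section module

/-- The Noether normalization as an algebra over itself through the iterated Frobenius. -/
def FNoe (_ _ : ℕ) : Type := NoeRing k

instance commRing_fNoe : CommRing (FNoe k p e) := inferInstanceAs (CommRing (NoeRing k))

instance algebra_fNoe : Algebra (NoeRing k) (FNoe k p e) :=
  (iterateFrobenius (NoeRing k) p e).toAlgebra

/-- The identity map onto the Frobenius copy. -/
def toFNoe : NoeRing k ≃+* FNoe k p e := RingEquiv.refl (NoeRing k)

lemma smul_toFNoe (a b : NoeRing k) :
    a • toFNoe k p e b = toFNoe k p e (a ^ p ^ e * b) := rfl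

/-- The monomials with exponents less than `p ^ e`, as a basis over the image of Frobenius. -/
def basisFNoe [PerfectRing k p] :
    Module.Basis (Option (Fin 2) → Fin (p ^ e)) (NoeRing k) (FNoe k p e) :=
  .mk (v := fun j => toFNoe k p e (monomial (expOf j) 1))
    (by
      rw [Fintype.linearIndependent_iff]
      intro g hg
      simp only [smul_toFNoe, ← map_sum] at hg
      exact eq_zero_of_sum_pow_mul_monomial p e
        ((map_eq_zero_iff _ (toFNoe k p e).injective).mp hg))
    (by
      intro f _
      obtain ⟨f, rfl⟩ := (toFNoe k p e).surjective f
      obtain ⟨g, rfl⟩ := exists_sum_pow_mul_monomial p e f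
      rw [Submodule.mem_span_range_iff_exists_fun]
      exact ⟨g, by simp only [smul_toFNoe, ← map_sum]⟩)

lemma eRscr_smul (r : Rscr k) (m : eRscr k p e) :
    r • m = (r ^ p ^ e * (show Rscr k from m) : Rscr k) := rfl

instance module_noeRing_eRscr : Module (NoeRing k) (eRscr k p e) :=
  Module.compHom _ (algebraMap (NoeRing k) (Rscr k))

instance isScalarTower_eRscr : IsScalarTower (NoeRing k) (Rscr k) (eRscr k p e) :=
  .of_compHom _ _ _

instance module_fNoe_eRscr : Module (FNoe k p e) (eRscr k p e) :=
  inferInstanceAs (Module (NoeRing k) (Rscr k))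

instance isScalarTower_fNoe_eRscr : IsScalarTower (NoeRing k) (FNoe k p e) (eRscr k p e) :=
  .of_algebraMap_smul fun a m => by
    change algebraMap (NoeRing k) (Rscr k) (a ^ p ^ e) * (show Rscr k from m) =
      (algebraMap (NoeRing k) (Rscr k) a) ^ p ^ e * (show Rscr k from m)
    rw [map_pow]

/-- A basis of `^eR` over the Noether normalization of `R`. -/
def basisERscr [PerfectRing k p] : Module.Basis (Fin (3 * p ^ (3 * e))) (NoeRing k) (eRscr k p e) :=
  ((basisFNoe k p e).smulTower
    (show Module.Basis (Fin 3) (FNoe k p e) (eRscr k p e) from basisNoether k)).reindex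
    (Fintype.equivFinOfCardEq (by
      rw [Fintype.card_prod, Fintype.card_pi]
      simp only [Fintype.card_fin, Finset.prod_const, Finset.card_univ, Fintype.card_option]
      rw [← pow_mul, mul_comm, mul_comm e]))

lemma kdim_eRscr_parIdeal [PerfectRing k p] :
    kdim k (Rscr k) (eRscr k p e ⧸ (parIdeal k • ⊤ : Submodule (Rscr k) (eRscr k p e))) =
      3 * p ^ (3 * e) :=
  (kdim_quot_of_basis (J := parIdeal k) rfl (kdim_irr k) (basisERscr k p e)).1

theorem kdim_tor_eRscr [PerfectRing k p] (i : ℕ) :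
    bettiScr k (i + 1) (eRscr k p e) + 2 ^ i * (3 * p ^ (3 * e)) =
      2 ^ i * (3 * kdim k (Rscr k)
        (eRscr k p e ⧸ (mScr k • ⊤ : Submodule (Rscr k) (eRscr k p e)))) := by
  have h0 : Module.Finite (NoeRing k) (eRscr k p e) := .of_basis (basisERscr k p e)
  have h1 : Module.Projective (NoeRing k) (eRscr k p e) := .of_basis (basisERscr k p e)
  have h2 : Module.Finite (Rscr k) (eRscr k p e) := .of_restrictScalars_finite (NoeRing k) _ _
  obtain ⟨_, h3, _, h4, _⟩ := gens_mem_mScr k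
  have := kdim_tor_succ (k := k) (A := NoeRing k) (J := parIdeal k) rfl
    (kdim_parIdeal k).1 (kdim_mScr k)
    (kdim_parIdeal k).2 (parIdeal_le k) (mScr_le k) h3 h4 (fun a => gxy_mul_mem k)
    (fun a => gxz_mul_mem k) (mem_mScr_of_mul_add_mul_mem k) i (eRscr k p e)
  rw [kdim_eRscr_parIdeal] at this
  exact this

end module

end frobeniusScroll

/-- The exponents of the monomials in `R`. -/
def Sig (n : Fin 3 →₀ ℕ) : Prop := ∃ d, n 0 + n 1 = n 2 + 2 * d

/-- The exponent of `x ^ a * y ^ b * z ^ c`. -/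
def vec (a b c : ℕ) : Fin 3 →₀ ℕ := Finsupp.equivFunOnFinite.symm ![a, b, c]

@[simp] lemma vec_zero (a b c : ℕ) : vec a b c 0 = a := rfl
@[simp] lemma vec_one (a b c : ℕ) : vec a b c 1 = b := rfl
@[simp] lemma vec_two (a b c : ℕ) : vec a b c 2 = c := rfl

lemma vec_eta (n : Fin 3 →₀ ℕ) : vec (n 0) (n 1) (n 2) = n := by
  ext i
  fin_cases i <;> rfl

section

variable {k : Type} [Field k]

lemma monomial_vec (a b c : ℕ) (r : k) :
    monomial (vec a b c) r = C r * (X 0 ^ a * X 1 ^ b * X 2 ^ c) := by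
  rw [monomial_eq, Finsupp.prod_fintype _ _ (by simp), Fin.prod_univ_three]
  simp

lemma sig_of_mem {f : MvPolynomial (Fin 3) k} (hf : f ∈ Rscr k) {n : Fin 3 →₀ ℕ}
    (hn : coeff n f ≠ 0) : Sig n := by
  induction hf using Algebra.adjoin_induction generalizing n with
  | mem f hf =>
    have hv (a b c : ℕ) (h : a + b = c + 2 ∨ a + b = c)
        (hn : coeff n (X 0 ^ a * X 1 ^ b * X 2 ^ c : MvPolynomial (Fin 3) k) ≠ 0) : Sig n := by
      have := monomial_vec a b c (1 : k)
      rw [C_1, one_mul] at this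
      rw [← this, coeff_monomial, ne_eq, ite_eq_right_iff, not_forall] at hn
      obtain ⟨rfl, _⟩ := hn
      rcases h with h | h
      · exact ⟨1, by simpa using h⟩
      · exact ⟨0, by simpa using h⟩
    rcases hf with rfl | rfl | rfl | rfl | rfl
    · exact hv 2 0 0 (by simp) (by simpa using hn)
    · exact hv 1 1 0 (by simp) (by simpa using hn)
    · exact hv 0 2 0 (by simp) (by simpa using hn)
    · exact hv 1 0 1 (by simp) (by simpa using hn)
    · exact hv 0 1 1 (by simp) (by simpa using hn)
  | algebraMap c =>
    classical
    rw [MvPolynomial.algebraMap_eq, coeff_C, ne_eq, ite_eq_right_iff, not_forall] at hn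
    obtain ⟨rfl, _⟩ := hn
    exact ⟨0, by simp⟩
  | add f g _ _ hf hg =>
    rw [coeff_add] at hn
    by_cases h : coeff n f = 0
    · exact hg (by simpa [h] using hn)
    · exact hf h
  | mul f g _ _ hf hg =>
    classical
    rw [coeff_mul] at hn
    obtain ⟨⟨a, b⟩, hab, h⟩ := Finset.exists_ne_zero_of_sum_ne_zero hn
    rw [Finset.HasAntidiagonal.mem_antidiagonal] at hab
    obtain ⟨d, hd⟩ := hf (left_ne_zero_of_mul h)
    obtain ⟨d', hd'⟩ := hg (right_ne_zero_of_mul h)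
    refine ⟨d + d', ?_⟩
    dsimp only at hab hd hd'
    simp only [← hab, Finsupp.add_apply]
    omega

lemma mon_mem (a b c d : ℕ) (h : a + b = c + 2 * d) :
    (X 0 ^ a * X 1 ^ b * X 2 ^ c : MvPolynomial (Fin 3) k) ∈ Rscr k := by
  induction hm : a + b + c using Nat.strong_induction_on generalizing a b c d with
  | _ m ih =>
    subst hm
    rcases Nat.eq_zero_or_pos c with rfl | hc
    · rcases a with _ | _ | a
      · rcases b with _ | _ | b
        · simp
        · omega
        · have := mul_mem (ih _ (by omega) 0 b 0 (d - 1) (by omega) rfl) (gy2 k).2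
          convert this using 1
          simp only [gy2]
          ring
      · rcases b with _ | b
        · omega
        · have := mul_mem (ih _ (by omega) 0 b 0 (d - 1) (by omega) rfl) (gxy k).2
          convert this using 1
          simp only [gxy]
          ring
      · have := mul_mem (ih _ (by omega) a b 0 (d - 1) (by omega) rfl) (gx2 k).2
        convert this using 1
        simp only [gx2]
        ring
    · obtain ⟨c, rfl⟩ : ∃ c', c = c' + 1 := ⟨c - 1, by omega⟩
      rcases a with _ | a
      · rcases b with _ | b
        · omega
        · have := mul_mem (ih _ (by omega) 0 b c d (by omega) rfl) (gyz k).2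
          convert this using 1
          simp only [gyz]
          ring
      · have := mul_mem (ih _ (by omega) a b c d (by omega) rfl) (gxz k).2
        convert this using 1
        simp only [gxz]
        ring

lemma monomial_mem {n : Fin 3 →₀ ℕ} (hn : Sig n) (c : k) : monomial n c ∈ Rscr k := by
  obtain ⟨d, hd⟩ := hn
  rw [← vec_eta n, monomial_vec]
  exact mul_mem (Subalgebra.algebraMap_mem _ c) (mon_mem _ _ _ d hd)

end

/-- The exponents of the monomials in `R` outside the Frobenius power `𝔪^[q]`. -/
def InE (q : ℕ) (n : Fin 3 →₀ ℕ) : Prop :=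
  Sig n ∧ (n 2 < q ∨ n 0 < q ∧ n 1 < q) ∧
    (n 0 + n 1 < n 2 + 2 * q ∨ n 0 < q ∧ n 1 < 2 * q ∨ n 1 < q ∧ n 0 < 2 * q)

section frob

variable {k : Type} [Field k] {p : ℕ} [Fact p.Prime] [CharP k p] {e : ℕ}

lemma coeff_gen_pow_mul {q : ℕ} {n : Fin 3 →₀ ℕ} (hn : InE q n) {x : Rscr k}
    (hx : x ∈ ({gx2 k, gxy k, gy2 k, gxz k, gyz k} : Set (Rscr k))) (r : Rscr k) :
    coeff n ((x ^ q * r : Rscr k) : MvPolynomial (Fin 3) k) = 0 := by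
  have hv (a b c : ℕ) (hx : (x : MvPolynomial (Fin 3) k) ^ q = X 0 ^ a * X 1 ^ b * X 2 ^ c)
      (h : vec a b c ≤ n → ¬ Sig (n - vec a b c)) :
      coeff n ((x ^ q * r : Rscr k) : MvPolynomial (Fin 3) k) = 0 := by
    have := monomial_vec a b c (1 : k)
    rw [C_1, one_mul] at this
    rw [Subalgebra.coe_mul, Subalgebra.coe_pow, hx, ← this, coeff_monomial_mul', one_mul]
    split_ifs with h1
    · by_contra h2
      exact h h1 (sig_of_mem r.2 h2)
    · rfl
  have hs (a b c : ℕ) (h : vec a b c ≤ n) (hS : Sig (n - vec a b c)) : a ≤ n 0 ∧ b ≤ n 1 ∧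
      c ≤ n 2 ∧ ∃ d, (n 0 - a) + (n 1 - b) = (n 2 - c) + 2 * d :=
    ⟨h 0, h 1, h 2, hS⟩
  obtain ⟨-, h1, h2⟩ := hn
  rcases hx with rfl | rfl | rfl | rfl | rfl
  · refine hv (2 * q) 0 0 (by simp only [gx2]; ring) fun h hS => ?_
    obtain ⟨_, _, _, d, hd⟩ := hs _ _ _ h hS
    omega
  · refine hv q q 0 (by simp only [gxy]; ring) fun h hS => ?_
    obtain ⟨_, _, _, d, hd⟩ := hs _ _ _ h hS
    omega
  · refine hv 0 (2 * q) 0 (by simp only [gy2]; ring) fun h hS => ?_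
    obtain ⟨_, _, _, d, hd⟩ := hs _ _ _ h hS
    omega
  · refine hv q 0 q (by simp only [gxz]; ring) fun h hS => ?_
    obtain ⟨_, _, _, d, hd⟩ := hs _ _ _ h hS
    omega
  · refine hv 0 q q (by simp only [gyz]; ring) fun h hS => ?_
    obtain ⟨_, _, _, d, hd⟩ := hs _ _ _ h hS
    omega

lemma coeff_smul_eq_zero {n : Fin 3 →₀ ℕ} (hn : InE (p ^ e) n) {x : Rscr k} (hx : x ∈ mScr k)
    (r : Rscr k) : coeff n ((x ^ p ^ e * r : Rscr k) : MvPolynomial (Fin 3) k) = 0 := by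
  induction hx using Submodule.span_induction generalizing r with
  | mem x hx => exact coeff_gen_pow_mul hn hx r
  | zero => simp [zero_pow (NeZero.ne (p ^ e))]
  | add x y _ _ hx hy =>
    have := congrArg₂ (· + ·) (hx r) (hy r)
    simp only [Subalgebra.coe_mul, Subalgebra.coe_pow, Subalgebra.coe_add, add_pow_char_pow,
      add_mul, coeff_add, add_zero] at *
    exact this
  | smul a x _ hx =>
    rw [smul_eq_mul, mul_pow, mul_comm (a ^ _), mul_assoc]
    exact hx _

lemma exists_eq_pow_mul {q : ℕ} {n : Fin 3 →₀ ℕ} (hS : Sig n) (hn : ¬ InE q n) (c : k) :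
    ∃ x ∈ mScr k, ∃ r : Rscr k, (monomial n c : MvPolynomial (Fin 3) k) = (x ^ q * r : Rscr k) := by
  obtain ⟨g1, g2, g3, g4, g5⟩ := gens_mem_mScr k
  obtain ⟨d, hd⟩ := hS
  have hmem (a b c' d : ℕ) (h : a + b = c' + 2 * d) :
      C c * (X 0 ^ a * X 1 ^ b * X 2 ^ c') ∈ Rscr k :=
    mul_mem (Subalgebra.algebraMap_mem _ c) (mon_mem _ _ _ d h)
  have h : (2 * q ≤ n 0 ∧ q ≤ d) ∨ (q ≤ n 0 ∧ q ≤ n 1 ∧ q ≤ d) ∨ (2 * q ≤ n 1 ∧ q ≤ d) ∨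
      (q ≤ n 0 ∧ q ≤ n 2) ∨ (q ≤ n 1 ∧ q ≤ n 2) := by
    by_contra h
    refine hn ⟨⟨d, hd⟩, ?_, ?_⟩ <;> omega
  rw [← vec_eta n, monomial_vec]
  generalize n 0 = a at *
  generalize n 1 = b at *
  generalize n 2 = c' at *
  rcases h with ⟨h1, h2⟩ | ⟨h1, h2, h3⟩ | ⟨h1, h2⟩ | ⟨h1, h2⟩ | ⟨h1, h2⟩
  · obtain ⟨a, rfl⟩ := Nat.exists_eq_add_of_le h1
    refine ⟨_, g1, ⟨_, hmem a b c' (d - q) (by omega)⟩, ?_⟩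
    simp only [Subalgebra.coe_mul, Subalgebra.coe_pow, gx2]
    ring
  · obtain ⟨a, rfl⟩ := Nat.exists_eq_add_of_le h1
    obtain ⟨b, rfl⟩ := Nat.exists_eq_add_of_le h2
    refine ⟨_, g2, ⟨_, hmem a b c' (d - q) (by omega)⟩, ?_⟩
    simp only [Subalgebra.coe_mul, Subalgebra.coe_pow, gxy]
    ring
  · obtain ⟨b, rfl⟩ := Nat.exists_eq_add_of_le h1
    refine ⟨_, g3, ⟨_, hmem a b c' (d - q) (by omega)⟩, ?_⟩
    simp only [Subalgebra.coe_mul, Subalgebra.coe_pow, gy2]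
    ring
  · obtain ⟨a, rfl⟩ := Nat.exists_eq_add_of_le h1
    obtain ⟨c', rfl⟩ := Nat.exists_eq_add_of_le h2
    refine ⟨_, g4, ⟨_, hmem a b c' d (by omega)⟩, ?_⟩
    simp only [Subalgebra.coe_mul, Subalgebra.coe_pow, gxz]
    ring
  · obtain ⟨b, rfl⟩ := Nat.exists_eq_add_of_le h1
    obtain ⟨c', rfl⟩ := Nat.exists_eq_add_of_le h2
    refine ⟨_, g5, ⟨_, hmem a b c' d (by omega)⟩, ?_⟩
    simp only [Subalgebra.coe_mul, Subalgebra.coe_pow, gyz]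
    ring

variable (k p e)

lemma mem_smul_top_iff (m : eRscr k p e) :
    m ∈ (mScr k • ⊤ : Submodule (Rscr k) (eRscr k p e)) ↔
      ∀ n, InE (p ^ e) n → coeff n (show Rscr k from m : MvPolynomial (Fin 3) k) = 0 := by
  constructor
  · intro h n hn
    induction h using Submodule.smul_induction_on' with
    | smul r hr m _ =>
      exact coeff_smul_eq_zero hn hr m
    | add x _ y _ hx hy =>
      exact (coeff_add n _ _).trans (by rw [hx, hy, add_zero])
  · intro h
    let N : AddSubgroup (Rscr k) :=
      (mScr k • ⊤ : Submodule (Rscr k) (eRscr k p e)).toAddSubgroup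
    have h1 : ((show Rscr k from m) : MvPolynomial (Fin 3) k) ∈
        N.map (Rscr k).val.toAddMonoidHom := by
      rw [(show Rscr k from m : MvPolynomial (Fin 3) k).as_sum]
      refine sum_mem fun n hn => ?_
      rw [mem_support_iff] at hn
      obtain ⟨x, hx, r, hr⟩ := exists_eq_pow_mul
        (sig_of_mem (show Rscr k from m).2 hn) (fun hE => hn (h n hE))
        (coeff n (show Rscr k from m : MvPolynomial (Fin 3) k))
      refine ⟨x ^ p ^ e * r, ?_, hr.symm⟩
      exact Submodule.smul_mem_smul (M := eRscr k p e) (n := r) hx trivial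
    obtain ⟨m', hm', hmm⟩ := h1
    have : m' = m := Subtype.ext hmm
    exact this ▸ hm'

/-- The triples `(a, b, d)` for which `x ^ a * y ^ b * z ^ (a + b - 2 * d)` is not in `𝔪^[q]`. -/
def triples (q : ℕ) : Finset (ℕ × ℕ × ℕ) :=
  {t ∈ Finset.range (3 * q) ×ˢ Finset.range (3 * q) ×ˢ Finset.range (3 * q) |
    2 * t.2.2 ≤ t.1 + t.2.1 ∧
    (t.1 + t.2.1 < q + 2 * t.2.2 ∨ t.1 < q ∧ t.2.1 < q) ∧
    (t.2.2 < q ∨ t.1 < q ∧ t.2.1 < 2 * q ∨ t.2.1 < q ∧ t.1 < 2 * q)}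

/-- The exponent attached to a triple. -/
def tri (t : ℕ × ℕ × ℕ) : Fin 3 →₀ ℕ := vec t.1 t.2.1 (t.1 + t.2.1 - 2 * t.2.2)

lemma inE_tri {q : ℕ} {t : ℕ × ℕ × ℕ} (ht : t ∈ triples q) : InE q (tri t) := by
  obtain ⟨a, b, d⟩ := t
  simp only [triples, Finset.mem_filter] at ht
  refine ⟨⟨d, ?_⟩, ?_⟩ <;> simp only [tri, vec_zero, vec_one, vec_two] <;> omega

lemma exists_tri {q : ℕ} {n : Fin 3 →₀ ℕ} (hn : InE q n) : ∃ t ∈ triples q, tri t = n := by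
  obtain ⟨⟨d, hd⟩, h⟩ := hn
  refine ⟨(n 0, n 1, d), ?_, ?_⟩
  · simp only [triples, Finset.mem_filter, Finset.mem_product, Finset.mem_range]
    omega
  · rw [← vec_eta n]
    simp only [tri, vec_zero, vec_one]
    rw [show n 0 + n 1 - 2 * d = n 2 by omega]

lemma tri_injOn {q : ℕ} {t t' : ℕ × ℕ × ℕ} (ht : t ∈ triples q) (ht' : t' ∈ triples q)
    (h : tri t = tri t') : t = t' := by
  obtain ⟨a, b, d⟩ := t
  obtain ⟨a', b', d'⟩ := t'
  simp only [triples, Finset.mem_filter] at ht ht'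
  have h0 := DFunLike.congr_fun h 0
  have h1 := DFunLike.congr_fun h 1
  have h2 := DFunLike.congr_fun h 2
  simp only [tri, vec_zero, vec_one, vec_two] at h0 h1 h2
  simp only [Prod.mk.injEq]
  omega

lemma kdim_eRscr_mScr [PerfectRing k p] :
    kdim k (Rscr k) (eRscr k p e ⧸ (mScr k • ⊤ : Submodule (Rscr k) (eRscr k p e))) =
      (triples (p ^ e)).card := by
  rw [← Fintype.card_coe]
  let θ : eRscr k p e →+ (triples (p ^ e) → k) :=
    { toFun := fun m t => (iterateFrobeniusEquiv k p e).symm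
        (coeff (tri t) (show Rscr k from m : MvPolynomial (Fin 3) k))
      map_zero' := by
        ext t
        exact map_zero (iterateFrobeniusEquiv k p e).symm
      map_add' := fun x y => by
        ext t
        exact map_add (iterateFrobeniusEquiv k p e).symm _ _ }
  have hθ (m : eRscr k p e) (t) : θ m t = (iterateFrobeniusEquiv k p e).symm
        (coeff (tri t) (show Rscr k from m : MvPolynomial (Fin 3) k)) := rfl
  refine kdim_quot_eq_card _ θ (fun c m => ?_) (fun f => ?_) (fun m => ?_)
  · ext t
    rw [Pi.smul_apply, hθ, hθ, RingEquiv.symm_apply_eq, smul_eq_mul, map_mul,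
      RingEquiv.apply_symm_apply, iterateFrobeniusEquiv_apply, iterateFrobenius_def, eRscr_smul]
    have : ((algebraMap k (Rscr k) c ^ p ^ e * (show Rscr k from m) : Rscr k) :
        MvPolynomial (Fin 3) k) = C (c ^ p ^ e) * ((show Rscr k from m : Rscr k) :
        MvPolynomial (Fin 3) k) := by
      rw [Subalgebra.coe_mul, Subalgebra.coe_pow, C_pow]
      rfl
    exact (congrArg _ this).trans (coeff_C_mul _ _ _)
  · let g : Rscr k := ∑ t : triples (p ^ e), ⟨monomial (tri t) (iterateFrobeniusEquiv k p e (f t)),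
      monomial_mem (inE_tri t.2).1 _⟩
    refine ⟨g, funext fun t => ?_⟩
    refine (hθ g t).trans ?_
    rw [RingEquiv.symm_apply_eq]
    change coeff (tri t) (g : MvPolynomial (Fin 3) k) = _
    simp only [g, AddSubmonoidClass.coe_finsetSum, coeff_sum, coeff_monomial]
    rw [Finset.sum_eq_single t]
    · simp
    · intro b _ hb
      rw [if_neg fun h => hb (Subtype.ext (tri_injOn b.2 t.2 h))]
    · simp
  · rw [mem_smul_top_iff, _root_.funext_iff]
    constructor
    · intro h n hn
      obtain ⟨t, ht, rfl⟩ := exists_tri hn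
      have := h ⟨t, ht⟩
      rw [hθ] at this
      simpa using this
    · intro h t
      rw [hθ, h _ (inE_tri t.2), map_zero]
      rfl

end frob

section counting

/-- Twice the approximate number of triples over `(a, b)`. -/
def slice (q a b : ℕ) : ℤ :=
  if a < q ∧ b < q then a + b
  else if a < q ∧ b < 2 * q ∨ b < q ∧ a < 2 * q then q
  else if a + b < 3 * q then 3 * q - a - b else 0

/-- The triples over `(a, b)`. -/
def fiber (q a b : ℕ) : Finset ℕ := {d ∈ Finset.range (3 * q) | 2 * d ≤ a + b ∧
    (a + b < q + 2 * d ∨ a < q ∧ b < q) ∧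
    (d < q ∨ a < q ∧ b < 2 * q ∨ b < q ∧ a < 2 * q)}

lemma card_triples (q : ℕ) : (triples q).card =
    ∑ a ∈ Finset.range (3 * q), ∑ b ∈ Finset.range (3 * q), (fiber q a b).card := by
  simp only [triples, fiber, Finset.card_filter, Finset.sum_product]

lemma fiber_sub (q a b : ℕ) (ha : a < 3 * q) (hb : b < 3 * q) :
    |2 * ((fiber q a b).card : ℤ) - slice q a b| ≤ 2 := by
  unfold slice
  split_ifs with h1 h2 h3
  · have : fiber q a b = Finset.Ico 0 ((a + b) / 2 + 1) := by
      ext d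
      simp only [fiber, Finset.mem_filter, Finset.mem_range, Finset.mem_Ico]
      omega
    rw [this, Nat.card_Ico, abs_le]
    omega
  · have : fiber q a b = Finset.Ico ((a + b - q) / 2 + 1) ((a + b) / 2 + 1) := by
      ext d
      simp only [fiber, Finset.mem_filter, Finset.mem_range, Finset.mem_Ico]
      omega
    rw [this, Nat.card_Ico, abs_le]
    omega
  · have : fiber q a b = Finset.Ico ((a + b - q) / 2 + 1) q := by
      ext d
      simp only [fiber, Finset.mem_filter, Finset.mem_range, Finset.mem_Ico]
      omega
    rw [this, Nat.card_Ico, abs_le]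
    omega
  · have : fiber q a b = ∅ := by
      ext d
      simp only [fiber, Finset.mem_filter, Finset.mem_range, Finset.notMem_empty, iff_false]
      omega
    rw [this]
    simp

lemma sum_range_three_mul (q : ℕ) (f : ℕ → ℤ) : ∑ a ∈ Finset.range (3 * q), f a =
    ∑ a ∈ Finset.range q, (f a + f (q + a) + f (2 * q + a)) := by
  rw [show 3 * q = q + q + q by ring, Finset.sum_range_add, Finset.sum_range_add,
    Finset.sum_add_distrib, Finset.sum_add_distrib, ← two_mul]

lemma sum_range_cast (n : ℕ) : 2 * ∑ b ∈ Finset.range n, (b : ℤ) = n * (n - 1) := by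
  induction n with
  | zero => simp
  | succ n ih => rw [Finset.sum_range_succ, mul_add, ih]; push_cast; ring

lemma sum_range_sub_ite (q a : ℕ) (ha : a < q) :
    2 * ∑ b ∈ Finset.range q, (if a + b < q then (q : ℤ) - a - b else 0) =
      (q - a) * (q - a + 1) := by
  obtain ⟨m, rfl⟩ := Nat.exists_eq_add_of_le ha.le
  rw [← Finset.sum_filter, show {b ∈ Finset.range (a + m) | a + b < a + m} = Finset.range m by
    ext b
    simp only [Finset.mem_filter, Finset.mem_range]
    omega]
  have := sum_range_cast m
  simp only [Nat.cast_add, add_sub_cancel_left, Finset.sum_sub_distrib, Finset.sum_const,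
    Finset.card_range, nsmul_eq_mul, mul_sub, this]
  ring

lemma sum_range_mul_succ (q : ℕ) :
    3 * ∑ a ∈ Finset.range q, ((q : ℤ) - a) * (q - a + 1) = q * (q + 1) * (q + 2) := by
  have h (n : ℕ) : 3 * ∑ a ∈ Finset.range n, ((a : ℤ) + 1) * (a + 2) = n * (n + 1) * (n + 2) := by
    induction n with
    | zero => simp
    | succ n ih => rw [Finset.sum_range_succ, mul_add, ih]; push_cast; ring
  rw [← h, ← Finset.sum_range_reflect]
  congr 1
  refine Finset.sum_congr rfl fun a ha => ?_
  rw [Finset.mem_range] at ha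
  rw [show ((q - 1 - a : ℕ) : ℤ) = q - 1 - a by omega]
  ring

lemma sum_slice (q : ℕ) :
    2 * ∑ a ∈ Finset.range (3 * q), ∑ b ∈ Finset.range (3 * q), slice q a b =
      7 * q ^ 3 + q ^ 2 + 2 * q := by
  have h : ∑ a ∈ Finset.range (3 * q), ∑ b ∈ Finset.range (3 * q), slice q a b =
      ∑ a ∈ Finset.range q, ∑ b ∈ Finset.range q,
        ((a : ℤ) + b + 2 * q + 3 * (if a + b < q then (q : ℤ) - a - b else 0)) := by
    rw [sum_range_three_mul]
    refine Finset.sum_congr rfl fun a ha => ?_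
    simp only [sum_range_three_mul q, ← Finset.sum_add_distrib]
    refine Finset.sum_congr rfl fun b hb => ?_
    rw [Finset.mem_range] at ha hb
    have h00 : slice q a b = a + b := by unfold slice; split_ifs <;> omega
    have h01 : slice q a (q + b) = q := by unfold slice; split_ifs <;> omega
    have h10 : slice q (q + a) b = q := by unfold slice; split_ifs <;> omega
    have h02 : slice q a (2 * q + b) = if a + b < q then (q : ℤ) - a - b else 0 := by
      unfold slice; split_ifs <;> omega
    have h20 : slice q (2 * q + a) b = if a + b < q then (q : ℤ) - a - b else 0 := by
      unfold slice; split_ifs <;> omega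
    have h11 : slice q (q + a) (q + b) = if a + b < q then (q : ℤ) - a - b else 0 := by
      unfold slice; split_ifs <;> omega
    have h12 : slice q (q + a) (2 * q + b) = 0 := by unfold slice; split_ifs <;> omega
    have h21 : slice q (2 * q + a) (q + b) = 0 := by unfold slice; split_ifs <;> omega
    have h22 : slice q (2 * q + a) (2 * q + b) = 0 := by unfold slice; split_ifs <;> omega
    rw [h00, h01, h02, h10, h11, h12, h20, h21, h22]
    ring
  have h2 : 2 * ∑ a ∈ Finset.range q, ∑ b ∈ Finset.range q,
      (if a + b < q then (q : ℤ) - a - b else 0) =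
      ∑ a ∈ Finset.range q, ((q : ℤ) - a) * (q - a + 1) := by
    rw [Finset.mul_sum]
    exact Finset.sum_congr rfl fun a ha => sum_range_sub_ite q a (Finset.mem_range.1 ha)
  have h3 := sum_range_mul_succ q
  have h4 := sum_range_cast q
  rw [h]
  simp only [Finset.sum_add_distrib, ← Finset.mul_sum, Finset.sum_const, Finset.card_range,
    nsmul_eq_mul]
  linear_combination 3 * h2 + h3 + 2 * q * h4

lemma card_triples_sub (q : ℕ) :
    |4 * ((triples q).card : ℤ) - (7 * q ^ 3 + q ^ 2 + 2 * q)| ≤ 36 * (q : ℤ) ^ 2 := by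
  have h : |∑ a ∈ Finset.range (3 * q), ∑ b ∈ Finset.range (3 * q),
      (2 * ((fiber q a b).card : ℤ) - slice q a b)| ≤
      ∑ a ∈ Finset.range (3 * q), ∑ b ∈ Finset.range (3 * q), 2 := by
    refine (Finset.abs_sum_le_sum_abs _ _).trans (Finset.sum_le_sum fun a ha => ?_)
    refine (Finset.abs_sum_le_sum_abs _ _).trans (Finset.sum_le_sum fun b hb => ?_)
    exact fiber_sub q a b (Finset.mem_range.1 ha) (Finset.mem_range.1 hb)
  have h1 := sum_slice q
  simp only [Finset.sum_sub_distrib, ← Finset.mul_sum, Finset.sum_const, Finset.card_range,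
    nsmul_eq_mul] at h
  rw [card_triples]
  push_cast at h ⊢
  rw [abs_le] at h ⊢
  constructor <;> nlinarith [h.1, h.2]

lemma tendsto_card_triples :
    Tendsto (fun q : ℕ => ((triples q).card : ℝ) / (q : ℝ) ^ 3) atTop (nhds (7 / 4)) := by
  rw [tendsto_iff_norm_sub_tendsto_zero]
  refine squeeze_zero' (Eventually.of_forall fun _ => norm_nonneg _) ?_
    (tendsto_const_div_atTop_nhds_zero_nat 10)
  filter_upwards [eventually_ge_atTop 1] with q hq
  have hq : (1 : ℝ) ≤ q := by exact_mod_cast hq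
  have h : |4 * ((triples q).card : ℝ) - (7 * q ^ 3 + q ^ 2 + 2 * q)| ≤ 36 * (q : ℝ) ^ 2 := by
    exact_mod_cast card_triples_sub q
  have hq3 : (0 : ℝ) < (q : ℝ) ^ 3 := by positivity
  rw [Real.norm_eq_abs, show ((triples q).card : ℝ) / (q : ℝ) ^ 3 - 7 / 4 =
    ((triples q).card - 7 / 4 * (q : ℝ) ^ 3) / (q : ℝ) ^ 3 by field_simp, abs_div,
    abs_of_pos hq3, show (10 : ℝ) / q = 10 * q ^ 2 / q ^ 3 by field_simp]
  gcongr
  rw [abs_le] at h ⊢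
  constructor <;> nlinarith [h.1, h.2]

end counting

theorem tendsto_bettiScr_div (p : ℕ) [Fact p.Prime] (k : Type) [Field k] [IsAlgClosed k]
    [CharP k p] (i : ℕ) (hi : 1 ≤ i) :
    Tendsto (fun e : ℕ => (bettiScr k i ↥(eRscr k p e) : ℝ) / (p : ℝ) ^ (3 * e)) atTop
      (nhds ((9 / 4) * 2 ^ (i - 1))) := by
  obtain ⟨i, rfl⟩ := Nat.exists_eq_add_of_le' hi
  have hp : (0 : ℝ) < p := by exact_mod_cast (Fact.out : p.Prime).pos
  have hT := tendsto_card_triples.comp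
    (tendsto_pow_atTop_atTop_of_one_lt (Fact.out : p.Prime).one_lt)
  have h : (fun e : ℕ => (bettiScr k (i + 1) ↥(eRscr k p e) : ℝ) / (p : ℝ) ^ (3 * e)) =
      fun e : ℕ => 2 ^ i * (3 * (((triples (p ^ e)).card : ℝ) / ((p ^ e : ℕ) : ℝ) ^ 3) - 3) := by
    funext e
    have h := kdim_tor_eRscr k p e i
    rw [kdim_eRscr_mScr] at h
    have h' : (bettiScr k (i + 1) (eRscr k p e) : ℝ) + 2 ^ i * (3 * p ^ (3 * e)) =
      2 ^ i * (3 * (triples (p ^ e)).card) := by exact_mod_cast h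
    rw [Nat.cast_pow, ← pow_mul, mul_comm e 3, eq_sub_of_add_eq h']
    field_simp
  rw [h, add_tsub_cancel_right, show (9 / 4 * 2 ^ i : ℝ) = 2 ^ i * (3 * (7 / 4) - 3) by ring]
  exact ((hT.const_mul 3).sub_const 3).const_mul _

end Scroll

theorem frobeniusBetti_scroll (p : ℕ) [Fact p.Prime] (k : Type) [Field k] [IsAlgClosed k]
    [CharP k p] (i : ℕ) (hi : 1 ≤ i) :
    Tendsto (fun e : ℕ => (bettiScr k i ↥(eRscr k p e) : ℝ) / (p : ℝ) ^ (3 * e)) atTop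
      (nhds ((9 / 4) * 2 ^ (i - 1))) :=
  Scroll.tendsto_bettiScr_div p k i hi
end
end

section
/- Let k be an algebraically closed field of prime characteristic p, q = p^e > 2, and let M ⊆ ^eS be the R-submodule spanned over k by all monomials x^i y^j z^k of S with i + j + k even and i + j ≥ k (so that M ≅ ^eR as R-modules). If M ≅ R^a ⊕ N as R-modules where N has no free direct summand, then a = #{(i,j,k) ∈ ℤ³ : 0 ≤ i,j,k < q, i+j+k even, i+j ≥ k}. -/
open MvPolynomial CategoryTheory Filter

set_option synthInstance.maxHeartbeats 1000000
set_option maxHeartbeats 2000000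

noncomputable section

variable (k : Type) [Field k]

/-- `^eS` : `S = k[x,y,z]` viewed as an `R`-module via the `e`-th iterate of the Frobenius
of `S`. -/
def eSscr (p : ℕ) [Fact p.Prime] [CharP k p] (e : ℕ) : ModuleCat ↥(Rscr k) :=
  (ModuleCat.restrictScalars
    ((iterateFrobenius (MvPolynomial (Fin 3) k) p e).comp (Rscr k).val.toRingHom)).obj
    (ModuleCat.of (MvPolynomial (Fin 3) k) (MvPolynomial (Fin 3) k))

/-- A polynomial in `S`, regarded as an element of `^eS`. -/
def toESscr (p : ℕ) [Fact p.Prime] [CharP k p] (e : ℕ) (g : MvPolynomial (Fin 3) k) :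
    ↥(eSscr k p e) := g

/-- `M ⊆ ^eS`: the `R`-submodule spanned by the monomials `x^i y^j z^k` with
`i+j+k` even and `i+j ≥ k`; it is isomorphic to `^eR` as an `R`-module. -/
def Mscr (p : ℕ) [Fact p.Prime] [CharP k p] (e : ℕ) : Submodule ↥(Rscr k) ↥(eSscr k p e) :=
  Submodule.span ↥(Rscr k)
    { g | ∃ a b c : ℕ, Even (a + b + c) ∧ c ≤ a + b ∧
        g = toESscr k p e (X 0 ^ a * X 1 ^ b * X 2 ^ c) }


section GeneralPosition

theorem exists_linearIndependent_comp_of_le_finrank_span {K V ι : Type*} [Field K]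
    [AddCommGroup V] [Module K V] [Finite ι] (v : ι → V) {r : ℕ}
    (hr : r ≤ Module.finrank K (Submodule.span K (Set.range v))) :
    ∃ γ : Fin r → ι, LinearIndependent K (v ∘ γ) := by
  obtain ⟨κ, f, hf, hspan, hli⟩ := exists_linearIndependent' K v
  have : Finite κ := Finite.of_injective f hf
  have := Fintype.ofFinite κ
  rw [← hspan, finrank_span_eq_card hli] at hr
  obtain ⟨g⟩ : Nonempty (Fin r ↪ κ) := Function.Embedding.nonempty_of_card_le (by simpa using hr)
  exact ⟨f ∘ g, hli.comp g g.injective⟩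

theorem Matrix.exists_submatrix_det_ne_zero_of_le_rank {K I J : Type*} [Field K] [Fintype I]
    [Fintype J] (A : Matrix I J K) {r : ℕ} (hr : r ≤ A.rank) :
    ∃ (ρ : Fin r → I) (γ : Fin r → J), (A.submatrix ρ γ).det ≠ 0 := by
  rw [Matrix.rank_eq_finrank_span_row] at hr
  obtain ⟨ρ, hρ⟩ := exists_linearIndependent_comp_of_le_finrank_span _ hr
  have hB : (A.submatrix ρ id).rank = r := by
    simpa using LinearIndependent.rank_matrix (M := A.submatrix ρ id) hρ
  have hB' := hB.ge
  rw [Matrix.rank_eq_finrank_span_cols] at hB'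
  obtain ⟨γ, hγ⟩ := exists_linearIndependent_comp_of_le_finrank_span _ hB'
  refine ⟨ρ, γ, ?_⟩
  rw [← isUnit_iff_ne_zero, ← Matrix.isUnit_iff_isUnit_det,
    ← Matrix.linearIndependent_cols_iff_isUnit]
  exact hγ

theorem Matrix.rank_add_le' {K I J : Type*} [Field K] [Fintype I] [Fintype J]
    (A B : Matrix I J K) : (A + B).rank ≤ A.rank + B.rank := by
  rw [Matrix.rank, Matrix.rank, Matrix.rank, Matrix.mulVecLin_add]
  have h := LinearMap.rank_add_le A.mulVecLin B.mulVecLin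
  simp only [LinearMap.rank, ← Module.finrank_eq_rank] at h
  exact_mod_cast h

variable {k : Type} [Field k]

theorem exists_polynomial_vanishing_of_card_lt {I τ : Type} [Fintype I] [Fintype τ]
    (h : Fintype.card τ < Fintype.card I) (g : I → MvPolynomial τ k) :
    ∃ H : MvPolynomial I k, H ≠ 0 ∧ ∀ s : τ → k, eval (fun i => eval s (g i)) H = 0 := by
  have hdep : ¬ AlgebraicIndependent k g := fun hg => by
    have := hg.cardinalMk_le_trdeg
    rw [MvPolynomial.trdeg_of_isDomain] at this
    simp only [Cardinal.mk_fintype, Cardinal.lift_natCast, Nat.cast_le] at this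
    omega
  rw [algebraicIndependent_iff] at hdep
  push Not at hdep
  obtain ⟨H, hH, hne⟩ := hdep
  refine ⟨H, hne, fun s => ?_⟩
  have := congrArg (aeval s) hH
  rw [map_zero, ← AlgHom.comp_apply, comp_aeval] at this
  simpa [aeval_eq_eval] using this

theorem exists_polynomial_vanishing_of_submatrix_det_ne_zero {I J : Type} [Fintype I] [Fintype J]
    {d r : ℕ} (hdr : d < r) (G : Matrix I J (MvPolynomial (Fin d) k))
    (ρ : Fin r → I) (γ : Fin r → J) :
    ∃ H : MvPolynomial I k, H ≠ 0 ∧ ∀ (t : Fin d → k) (c : I → k),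
      ((G.map (eval t)).submatrix ρ γ).det ≠ 0 → Matrix.vecMul c (G.map (eval t)) = 0 →
        eval c H = 0 := by
  classical
  by_cases hρ : Function.Injective ρ
  swap
  · refine ⟨1, one_ne_zero, fun t c hdet => absurd ?_ hdet⟩
    simp only [Function.Injective, not_forall] at hρ
    obtain ⟨i, j, hij, hne⟩ := hρ
    exact Matrix.det_zero_of_row_eq hne (by ext; simp [hij])
  let U := {i // i ∉ Set.range ρ}
  let P := MvPolynomial (Fin d ⊕ U) k
  let G' : Matrix I J P := G.map (rename Sum.inl)
  let E : Matrix (Fin r) (Fin r) P := G'.submatrix ρ γ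
  let b : Fin r → P := fun j => ∑ u : U, X (Sum.inr u) * G' u (γ j)
  let s : Fin r → P := - Matrix.vecMul b E.adjugate
  let g : I → P := fun i => if h : i ∈ Set.range ρ then s h.choose else
    E.det * X (Sum.inr ⟨i, h⟩)
  have hcard : Fintype.card (Fin d ⊕ U) < Fintype.card I := by
    have h1 : Fintype.card U = Fintype.card I - Fintype.card (Set.range ρ) :=
      Fintype.card_subtype_compl _
    have h2 : Fintype.card (Set.range ρ) = r := by
      rw [Set.card_range_of_injective hρ, Fintype.card_fin]
    have h3 : Fintype.card (Set.range ρ) ≤ Fintype.card I := Fintype.card_subtype_le _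
    rw [Fintype.card_sum, Fintype.card_fin]
    omega
  obtain ⟨H, hH, hvan⟩ := exists_polynomial_vanishing_of_card_lt hcard g
  refine ⟨H, hH, fun t c hdet hc => ?_⟩
  set Δ := ((G.map (eval t)).submatrix ρ γ).det with hΔ
  let w : Fin d ⊕ U → k := Sum.elim t (fun u => c u / Δ)
  have hG' : ∀ i j, eval w (G' i j) = eval t (G i j) := fun i j => by
    simp only [G', Matrix.map_apply, eval_rename]
    congr 1
  have hE : E.map (eval w) = (G.map (eval t)).submatrix ρ γ := by
    ext i j
    simp [E, hG']
  have hEdet : eval w E.det = Δ := by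
    rw [RingHom.map_det, hΔ, ← hE]
    rfl
  have hEadj : E.adjugate.map (eval w) = ((G.map (eval t)).submatrix ρ γ).adjugate := by
    rw [← hE]
    exact RingHom.map_adjugate (eval w) E
  have hb : Δ • (fun j => eval w (b j)) =
      - Matrix.vecMul (c ∘ ρ) ((G.map (eval t)).submatrix ρ γ) := by
    ext j
    have hj := congrFun hc (γ j)
    simp only [Matrix.vecMul, dotProduct, Matrix.map_apply, Pi.zero_apply] at hj
    rw [← Finset.sum_add_sum_compl (Finset.univ.image ρ),
      Finset.sum_image (fun _ _ _ _ h => hρ h)] at hj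
    have hU : ∑ i ∈ (Finset.univ.image ρ)ᶜ, c i * eval t (G i (γ j)) =
        ∑ u : U, c u * eval t (G u (γ j)) := by
      refine Finset.sum_subtype _ (fun i => ?_) _
      simp
    rw [hU] at hj
    simp only [b, map_sum, map_mul, eval_X, hG', Pi.smul_apply, smul_eq_mul, Pi.neg_apply,
      Matrix.vecMul, dotProduct, Matrix.submatrix_apply, Matrix.map_apply, Function.comp_apply,
      Finset.mul_sum, w, Sum.elim_inr]
    rw [eq_neg_iff_add_eq_zero, add_comm, ← hj]
    congr 1
    refine Finset.sum_congr rfl fun u _ => ?_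
    field_simp
  have hs : ∀ l, eval w (s l) = c (ρ l) := fun l => by
    have h1 : (fun l => eval w (s l)) = - Matrix.vecMul (fun j => eval w (b j))
        ((G.map (eval t)).submatrix ρ γ).adjugate := by
      ext l
      rw [← hEadj]
      simp [s, Matrix.vecMul, dotProduct]
    have h2 : Δ • (fun l => eval w (s l)) = Δ • (c ∘ ρ) := by
      rw [h1, smul_neg, ← Matrix.smul_vecMul, hb, Matrix.neg_vecMul, neg_neg,
        Matrix.vecMul_vecMul, Matrix.mul_adjugate, Matrix.vecMul_smul, Matrix.vecMul_one]
    have h3 := congrFun h2 l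
    simpa [hdet] using h3
  have hg : (fun i => eval w (g i)) = c := by
    ext i
    by_cases hi : i ∈ Set.range ρ
    · simp only [g, dif_pos hi, hs]
      rw [hi.choose_spec]
    · simp only [g, dif_neg hi, map_mul, hEdet, eval_X, w, Sum.elim_inr]
      field_simp
  have := hvan w
  rwa [hg] at this

theorem exists_polynomial_vanishing_of_le_rank {I J : Type} [Fintype I] [Fintype J]
    {d r : ℕ} (hdr : d < r) (G : Matrix I J (MvPolynomial (Fin d) k)) :
    ∃ H : MvPolynomial I k, H ≠ 0 ∧ ∀ (t : Fin d → k) (c : I → k),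
      r ≤ (G.map (eval t)).rank → Matrix.vecMul c (G.map (eval t)) = 0 → eval c H = 0 := by
  classical
  choose H hH hvan using exists_polynomial_vanishing_of_submatrix_det_ne_zero hdr G
  refine ⟨∏ ρ, ∏ γ, H ρ γ,
    Finset.prod_ne_zero_iff.2 fun ρ _ => Finset.prod_ne_zero_iff.2 fun γ _ => hH ρ γ,
    fun t c hr hc => ?_⟩
  obtain ⟨ρ, γ, hdet⟩ := Matrix.exists_submatrix_det_ne_zero_of_le_rank _ hr
  rw [map_prod, Finset.prod_eq_zero (Finset.mem_univ ρ)]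
  rw [map_prod, Finset.prod_eq_zero (Finset.mem_univ γ)]
  exact hvan ρ γ t c hdet hc

end GeneralPosition

section Scroll

variable {k}

/-- The generators of `Rscr k`, as an indexed family. -/
def scrollGen : Fin 5 → ↥(Rscr k) :=
  ![⟨X 0 ^ 2, Algebra.subset_adjoin (by simp [sgen])⟩,
    ⟨X 0 * X 1, Algebra.subset_adjoin (by simp [sgen])⟩,
    ⟨X 1 ^ 2, Algebra.subset_adjoin (by simp [sgen])⟩,
    ⟨X 0 * X 2, Algebra.subset_adjoin (by simp [sgen])⟩,
    ⟨X 1 * X 2, Algebra.subset_adjoin (by simp [sgen])⟩]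

theorem range_coe_scrollGen :
    Set.range (fun i => (scrollGen i : ↥(Rscr k)).1) = sgen k := by
  ext g
  simp only [Set.mem_range, Fin.exists_fin_succ, sgen, scrollGen]
  simp [eq_comm]

theorem aeval_scrollGen_surjective :
    Function.Surjective (aeval (R := k) (scrollGen (k := k))) := by
  intro r
  have hr : (r : MvPolynomial (Fin 3) k) ∈ Algebra.adjoin k (sgen k) := r.2
  rw [← range_coe_scrollGen, Algebra.adjoin_range_eq_range_aeval] at hr
  obtain ⟨g, hg⟩ := hr
  refine ⟨g, Subtype.ext ?_⟩
  rw [← hg]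
  change (Rscr k).val (aeval scrollGen g) = _
  rw [← AlgHom.comp_apply, comp_aeval]
  rfl

theorem scrollGen_mul_two : (scrollGen 0 * scrollGen 2 : ↥(Rscr k)) = scrollGen 1 ^ 2 :=
  Subtype.ext (by simp [scrollGen]; ring)

theorem scrollGen_mul_four : (scrollGen 0 * scrollGen 4 : ↥(Rscr k)) = scrollGen 1 * scrollGen 3 :=
  Subtype.ext (by simp [scrollGen]; ring)

theorem scrollGen_mul_three :
    (scrollGen 2 * scrollGen 3 : ↥(Rscr k)) = scrollGen 1 * scrollGen 4 :=
  Subtype.ext (by simp [scrollGen]; ring)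

theorem exists_scroll_chart [IsAlgClosed k] (x : ↥(Rscr k) →ₐ[k] k) :
    (∃ t : Fin 3 → k, ∀ i, x (scrollGen i) =
      eval t ((![X 0 ^ 2, X 0 * X 1, X 1 ^ 2, X 0 * X 2, X 1 * X 2] :
        Fin 5 → MvPolynomial (Fin 3) k) i)) ∨
    ∃ t : Fin 2 → k, ∀ i, x (scrollGen i) =
      eval t ((![0, 0, 0, X 0, X 1] : Fin 5 → MvPolynomial (Fin 2) k) i) := by
  have h2 := congrArg x scrollGen_mul_two
  have h3 := congrArg x scrollGen_mul_three
  have h4 := congrArg x scrollGen_mul_four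
  simp only [map_mul, map_pow] at h2 h3 h4
  by_cases h : x (scrollGen 0) = 0
  · have h1 : x (scrollGen 1) = 0 := by
      rw [h, zero_mul] at h2
      exact pow_eq_zero_iff two_ne_zero |>.1 h2.symm
    by_cases h' : x (scrollGen 2) = 0
    · refine Or.inr ⟨![x (scrollGen 3), x (scrollGen 4)], fun i => ?_⟩
      fin_cases i <;> simp [h, h1, h']
    · obtain ⟨z, hz⟩ := IsAlgClosed.exists_pow_nat_eq (x (scrollGen 2)) two_pos
      have hz0 : z ≠ 0 := by rintro rfl; simp at hz; exact h' hz.symm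
      refine Or.inl ⟨![x (scrollGen 1) / z, z, x (scrollGen 4) / z], fun i => ?_⟩
      have h5 : x (scrollGen 3) = 0 := by
        rw [h1, zero_mul] at h3
        exact (mul_eq_zero.1 h3).resolve_left h'
      fin_cases i <;> simp [h, h1, hz, h5]
      field_simp
  · obtain ⟨z, hz⟩ := IsAlgClosed.exists_pow_nat_eq (x (scrollGen 0)) two_pos
    have hz0 : z ≠ 0 := by rintro rfl; simp at hz; exact h hz.symm
    refine Or.inl ⟨![z, x (scrollGen 1) / z, x (scrollGen 3) / z], fun i => ?_⟩
    fin_cases i <;> simp [hz]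
    · field_simp
    · rw [div_pow, hz, ← h2]
      field_simp
    · field_simp
    · rw [div_mul_div_comm, ← pow_two, hz, ← h4]
      field_simp

theorem exists_polynomial_vanishing_of_chart {I J : Type} [Fintype I] [Fintype J]
    (G : Matrix I J ↥(Rscr k)) {d r : ℕ} (hdr : d < r) (σ : Fin 5 → MvPolynomial (Fin d) k) :
    ∃ H : MvPolynomial I k, H ≠ 0 ∧ ∀ (x : ↥(Rscr k) →ₐ[k] k) (c : I → k),
      (∃ t : Fin d → k, ∀ i, x (scrollGen i) = eval t (σ i)) → r ≤ (G.map x).rank →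
        Matrix.vecMul c (G.map x) = 0 → eval c H = 0 := by
  choose G' hG' using fun i j => aeval_scrollGen_surjective (G i j)
  obtain ⟨H, hH, hvan⟩ := exists_polynomial_vanishing_of_le_rank hdr
    (Matrix.of fun i j => aeval σ (G' i j))
  refine ⟨H, hH, fun x c ⟨t, ht⟩ hr hc => ?_⟩
  have hG : G.map x = (Matrix.of fun i j => aeval σ (G' i j)).map (eval t) := by
    ext i j
    simp only [Matrix.map_apply, Matrix.of_apply, ← hG']
    rw [← coe_aeval_eq_eval, RingHom.coe_coe, ← AlgHom.comp_apply, ← AlgHom.comp_apply,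
      comp_aeval, comp_aeval]
    congr 2
    ext i
    simp [ht, aeval_eq_eval]
  rw [hG] at hr hc
  exact hvan t c hr hc

theorem exists_vecMul_map_ne_zero [IsAlgClosed k] {I J : Type} [Fintype I] [Fintype J]
    (G : Matrix I J ↥(Rscr k))
    (h0 : ∀ x : ↥(Rscr k) →ₐ[k] k, (∀ i, x (scrollGen i) = 0) → 1 ≤ (G.map x).rank)
    (h4 : ∀ x : ↥(Rscr k) →ₐ[k] k, ¬ (∀ i, x (scrollGen i) = 0) → 4 ≤ (G.map x).rank) :
    ∃ c : I → k, ∀ x : ↥(Rscr k) →ₐ[k] k, Matrix.vecMul c (G.map x) ≠ 0 := by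
  obtain ⟨H₀, hH₀, hv₀⟩ := exists_polynomial_vanishing_of_chart G zero_lt_one 0
  obtain ⟨H₁, hH₁, hv₁⟩ := exists_polynomial_vanishing_of_chart G (by norm_num : 3 < 4)
    ![X 0 ^ 2, X 0 * X 1, X 1 ^ 2, X 0 * X 2, X 1 * X 2]
  obtain ⟨H₂, hH₂, hv₂⟩ := exists_polynomial_vanishing_of_chart G (by norm_num : 2 < 4)
    ![0, 0, 0, X 0, X 1]
  have : Infinite k := IsAlgClosed.instInfinite
  obtain ⟨c, hc⟩ : ∃ c, eval c (H₀ * H₁ * H₂) ≠ 0 := by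
    by_contra! hcon
    exact mul_ne_zero (mul_ne_zero hH₀ hH₁) hH₂ (MvPolynomial.funext (by simpa using hcon))
  rw [map_mul, map_mul] at hc
  refine ⟨c, fun x hx => ?_⟩
  by_cases hx0 : ∀ i, x (scrollGen i) = 0
  · exact hc (by rw [hv₀ x c ⟨0, by simpa using hx0⟩ (h0 x hx0) hx]; simp)
  · rcases exists_scroll_chart x with ht | ht
    · exact hc (by rw [hv₁ x c ht (h4 x hx0) hx]; simp)
    · exact hc (by rw [hv₂ x c ht (h4 x hx0) hx]; simp)

theorem Rscr_finiteType : Algebra.FiniteType k ↥(Rscr k) :=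
  Algebra.FiniteType.of_surjective (aeval scrollGen) aeval_scrollGen_surjective

theorem exists_algHom_eq_zero_of_isMaximal {k A : Type} [Field k] [IsAlgClosed k] [CommRing A]
    [Algebra k A] [Algebra.FiniteType k A] (m : Ideal A) [m.IsMaximal] :
    ∃ x : A →ₐ[k] k, ∀ r ∈ m, x r = 0 := by
  let := Ideal.Quotient.field m
  have : Algebra.FiniteType k (A ⧸ m) :=
    Algebra.FiniteType.of_surjective (Ideal.Quotient.mkₐ k m) Ideal.Quotient.mk_surjective
  have : Module.Finite k (A ⧸ m) := finite_of_finite_type_of_isJacobsonRing k (A ⧸ m)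
  let E := AlgEquiv.ofBijective (Algebra.ofId k (A ⧸ m))
    (IsAlgClosed.algebraMap_bijective_of_isIntegral (k := k))
  refine ⟨E.symm.toAlgHom.comp (Ideal.Quotient.mkₐ k m), fun r hr => ?_⟩
  have h : Ideal.Quotient.mk m r = 0 := Ideal.Quotient.eq_zero_iff_mem.2 hr
  simp [h]

theorem LinearMap.surjective_of_forall_algHom {k A N : Type*} [CommRing A] [CommRing k]
    [Algebra k A] [AddCommGroup N] [Module A N]
    (hA : ∀ m : Ideal A, m.IsMaximal → ∃ x : A →ₐ[k] k, ∀ r ∈ m, x r = 0)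
    (f : N →ₗ[A] A) (hf : ∀ x : A →ₐ[k] k, ∃ v, x (f v) ≠ 0) : Function.Surjective f := by
  rw [← LinearMap.range_eq_top]
  by_contra hne
  obtain ⟨m, hm, hle⟩ := Ideal.exists_le_maximal (LinearMap.range f : Ideal A) hne
  obtain ⟨x, hx⟩ := hA m hm
  obtain ⟨v, hv⟩ := hf x
  exact hv (hx _ (hle ⟨v, rfl⟩))

theorem LinearMap.nonempty_equiv_prod_ker_of_surjective {A N : Type*} [CommRing A]
    [AddCommGroup N] [Module A N] (f : N →ₗ[A] A) (hf : Function.Surjective f) :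
    Nonempty (N ≃ₗ[A] A × LinearMap.ker f) := by
  obtain ⟨v, hv⟩ := hf 1
  let g : N →ₗ[A] LinearMap.ker f :=
    (LinearMap.id - LinearMap.toSpanSingleton A N v ∘ₗ f).codRestrict _ (by simp [hv])
  let h : A × LinearMap.ker f →ₗ[A] N :=
    LinearMap.coprod (LinearMap.toSpanSingleton A N v) (LinearMap.ker f).subtype
  refine ⟨LinearEquiv.ofLinearMap (f.prod g) h ?_ ?_⟩
  · ext <;> simp [g, h, hv]
  · ext; simp [g, h]

end Scroll

section Monomials

variable {k}

/-- The exponents of the monomials lying in `Rscr k`. -/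
def IsScroll (m : Fin 3 →₀ ℕ) : Prop := Even (m 0 + m 1 + m 2) ∧ m 2 ≤ m 0 + m 1

/-- The exponent of `x^a y^b z^c`. -/
def tri (a b c : ℕ) : Fin 3 →₀ ℕ := Finsupp.equivFunOnFinite.symm ![a, b, c]

@[simp] theorem tri_zero (a b c : ℕ) : tri a b c 0 = a := rfl

@[simp] theorem tri_one (a b c : ℕ) : tri a b c 1 = b := rfl

@[simp] theorem tri_two (a b c : ℕ) : tri a b c 2 = c := rfl

theorem ext_fin_three {m n : Fin 3 →₀ ℕ} (h0 : m 0 = n 0) (h1 : m 1 = n 1) (h2 : m 2 = n 2) :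
    m = n := by
  ext i
  fin_cases i <;> assumption

theorem monomial_fin_three (m : Fin 3 →₀ ℕ) :
    (monomial m 1 : MvPolynomial (Fin 3) k) = X 0 ^ m 0 * X 1 ^ m 1 * X 2 ^ m 2 := by
  rw [monomial_eq, Finsupp.prod_fintype _ _ (by simp), Fin.prod_univ_three, C_1, one_mul]

theorem IsScroll.add {m n : Fin 3 →₀ ℕ} (hm : IsScroll m) (hn : IsScroll n) :
    IsScroll (m + n) := by
  obtain ⟨⟨u, hu⟩, hm⟩ := hm
  obtain ⟨⟨v, hv⟩, hn⟩ := hn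
  refine ⟨⟨u + v, ?_⟩, ?_⟩ <;> simp only [Finsupp.add_apply] <;> omega

theorem X_pow_mul_mem_Rscr (a b c : ℕ) (he : Even (a + b + c)) (hc : c ≤ a + b) :
    (X 0 ^ a * X 1 ^ b * X 2 ^ c : MvPolynomial (Fin 3) k) ∈ Rscr k := by
  have key : ∀ g ∈ sgen k, ∀ h ∈ Rscr k, g * h ∈ Rscr k := fun g hg h hh =>
    mul_mem (Algebra.subset_adjoin hg) hh
  induction h : a + b + c using Nat.strong_induction_on generalizing a b c with
  | _ n ih =>
    subst h
    rw [Nat.even_iff] at he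
    rcases c with _ | c
    · rcases a with _ | _ | a
      · rcases b with _ | _ | b
        · simp
        · simp at he
        · have := key (X 1 ^ 2) (by simp [sgen]) _
            (ih (0 + b + 0) (by omega) 0 b 0 (by rw [Nat.even_iff]; omega) (by omega) rfl)
          convert this using 1
          ring
      · rcases b with _ | b
        · simp at he
        · have := key (X 0 * X 1) (by simp [sgen]) _
            (ih (0 + b + 0) (by omega) 0 b 0 (by rw [Nat.even_iff]; omega) (by omega) rfl)
          convert this using 1
          ring
      · have := key (X 0 ^ 2) (by simp [sgen]) _
          (ih (a + b + 0) (by omega) a b 0 (by rw [Nat.even_iff]; omega) (by omega) rfl)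
        convert this using 1
        ring
    · rcases a with _ | a
      · rcases b with _ | b
        · omega
        · have := key (X 1 * X 2) (by simp [sgen]) _
            (ih (0 + b + c) (by omega) 0 b c (by rw [Nat.even_iff]; omega) (by omega) rfl)
          convert this using 1
          ring
      · have := key (X 0 * X 2) (by simp [sgen]) _
          (ih (a + b + c) (by omega) a b c (by rw [Nat.even_iff]; omega) (by omega) rfl)
        convert this using 1
        ring

theorem monomial_mem_Rscr {m : Fin 3 →₀ ℕ} (hm : IsScroll m) :
    (monomial m 1 : MvPolynomial (Fin 3) k) ∈ Rscr k := by
  rw [monomial_fin_three]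
  exact X_pow_mul_mem_Rscr _ _ _ hm.1 hm.2

theorem basisMonomials_apply (m : Fin 3 →₀ ℕ) :
    basisMonomials (Fin 3) k m = monomial m 1 := by
  rw [coe_basisMonomials]

theorem sgen_eq_monomial {g : MvPolynomial (Fin 3) k} (hg : g ∈ sgen k) :
    ∃ m, IsScroll m ∧ g = monomial m 1 := by
  have key : ∀ a b c : ℕ, Even (a + b + c) → c ≤ a + b →
      ∃ m, IsScroll m ∧ (X 0 ^ a * X 1 ^ b * X 2 ^ c : MvPolynomial (Fin 3) k) = monomial m 1 :=
    fun a b c h1 h2 => ⟨tri a b c, ⟨h1, h2⟩, by simp [monomial_fin_three]⟩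
  rcases hg with rfl | rfl | rfl | rfl | rfl
  · simpa using key 2 0 0 (by decide) (by decide)
  · simpa using key 1 1 0 (by decide) (by decide)
  · simpa using key 0 2 0 (by decide) (by decide)
  · simpa using key 1 0 1 (by decide) (by decide)
  · simpa using key 0 1 1 (by decide) (by decide)

theorem toSubmodule_Rscr : Subalgebra.toSubmodule (Rscr k) =
    Submodule.span k {g | ∃ m, IsScroll m ∧ g = monomial m 1} := by
  apply le_antisymm
  · rw [Rscr, Algebra.adjoin_eq_span, Submodule.span_le]
    refine fun g hg => Submodule.subset_span ?_
    induction hg using Submonoid.closure_induction with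
    | mem g hg => exact sgen_eq_monomial hg
    | one => exact ⟨0, ⟨by simp, by simp⟩, rfl⟩
    | mul g h _ _ hg hh =>
      obtain ⟨m, hm, rfl⟩ := hg
      obtain ⟨n, hn, rfl⟩ := hh
      exact ⟨m + n, hm.add hn, by rw [monomial_mul, one_mul]⟩
  · rw [Submodule.span_le]
    rintro _ ⟨m, hm, rfl⟩
    exact monomial_mem_Rscr hm

theorem Rscr_induction {P : MvPolynomial (Fin 3) k → Prop} {s : MvPolynomial (Fin 3) k}
    (hs : s ∈ Rscr k) (hmon : ∀ m, IsScroll m → P (monomial m 1))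
    (hadd : ∀ s t, P s → P t → P (s + t)) (hsmul : ∀ (c : k) s, P s → P (c • s)) : P s := by
  rw [← Subalgebra.mem_toSubmodule, toSubmodule_Rscr] at hs
  induction hs using Submodule.span_induction with
  | mem g hg => obtain ⟨m, hm, rfl⟩ := hg; exact hmon m hm
  | zero => simpa using hsmul 0 _ (hmon 0 ⟨by simp, by simp⟩)
  | add s t _ _ h h' => exact hadd s t h h'
  | smul c s _ h => exact hsmul c s h

theorem map_mem_Rscr (φ : k →+* k) {s : MvPolynomial (Fin 3) k} (hs : s ∈ Rscr k) :
    map φ s ∈ Rscr k := by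
  refine Rscr_induction (P := fun s => map φ s ∈ Rscr k) hs (fun m hm => ?_)
    (fun s t h h' => ?_) (fun c s h => ?_)
  · rw [map_monomial, map_one]
    exact monomial_mem_Rscr hm
  · rw [map_add]
    exact add_mem h h'
  · rw [smul_eq_C_mul, map_mul, map_C, ← smul_eq_C_mul]
    exact Subalgebra.smul_mem _ h _

open Classical in
/-- The `k`-linear map with `x^m ↦ x^n` whenever `m = m₀ + q (n - K)` and `x^n` lies in `Rscr k`;
all the other monomials are sent to `0`. -/
def shiftMap (q : ℕ) (m₀ K : Fin 3 →₀ ℕ) : MvPolynomial (Fin 3) k →ₗ[k] MvPolynomial (Fin 3) k :=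
  (basisMonomials (Fin 3) k).constr k fun m =>
    if h : ∃ n, IsScroll n ∧ m + q • K = m₀ + q • n then monomial h.choose 1 else 0

variable {q : ℕ} {m₀ K : Fin 3 →₀ ℕ}

theorem shiftMap_monomial_eq_zero {m : Fin 3 →₀ ℕ}
    (h : ¬ ∃ n, IsScroll n ∧ m + q • K = m₀ + q • n) :
    shiftMap (k := k) q m₀ K (monomial m 1) = 0 := by
  rw [← basisMonomials_apply, shiftMap, Module.Basis.constr_basis, dif_neg h]

theorem shiftMap_monomial (hq : 0 < q) {m n : Fin 3 →₀ ℕ} (hn : IsScroll n)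
    (h : m + q • K = m₀ + q • n) : shiftMap (k := k) q m₀ K (monomial m 1) = monomial n 1 := by
  have hex : ∃ n, IsScroll n ∧ m + q • K = m₀ + q • n := ⟨n, hn, h⟩
  rw [← basisMonomials_apply, shiftMap, Module.Basis.constr_basis, dif_pos hex]
  have h2 : q • n = q • hex.choose := add_left_cancel (h.symm.trans hex.choose_spec.2)
  have h3 : n = hex.choose := smul_right_injective _ hq.ne' h2
  rw [← h3]

theorem shiftMap_mem_Rscr (s : MvPolynomial (Fin 3) k) : shiftMap q m₀ K s ∈ Rscr k := by
  classical
  rw [shiftMap, Module.Basis.constr_apply]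
  refine sum_mem fun m _ => Subalgebra.smul_mem _ ?_ _
  split_ifs with h
  · exact monomial_mem_Rscr h.choose_spec.1
  · exact zero_mem _

/-- The condition under which `shiftMap q m₀ K` is compatible with multiplication by `q`-th powers
of monomials in `Rscr k`. -/
structure IsAdmissible (q : ℕ) (m₀ K : Fin 3 →₀ ℕ) : Prop where
  lt : ∀ i, m₀ i < q + q * K i
  lt_add : m₀ 0 + m₀ 1 + q * K 2 < 2 * q + q * (K 0 + K 1) + m₀ 2

theorem shiftMap_monomial_add (hq : 0 < q) (hK : IsAdmissible q m₀ K) {m g : Fin 3 →₀ ℕ}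
    (hm : IsScroll m) (hg : IsScroll g) : shiftMap (k := k) q m₀ K (monomial (m + q • g) 1) =
      monomial g 1 * shiftMap q m₀ K (monomial m 1) := by
  by_cases h : ∃ n, IsScroll n ∧ m + q • K = m₀ + q • n
  · obtain ⟨n, hn, h⟩ := h
    rw [shiftMap_monomial hq hn h, monomial_mul, one_mul, shiftMap_monomial hq (hg.add hn)]
    rw [add_right_comm, h, smul_add]
    abel
  · rw [shiftMap_monomial_eq_zero h, mul_zero, shiftMap_monomial_eq_zero]
    rintro ⟨n', hn', h'⟩
    have hcoord : ∀ i, m i + q * g i + q * K i = m₀ i + q * n' i := fun i => by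
      simpa using DFunLike.congr_fun h' i
    have hle : g ≤ n' := fun i => by
      by_contra! hlt
      have h1 := Nat.mul_le_mul_left q (Nat.succ_le_of_lt hlt)
      have h2 := hK.lt i
      have h3 := hcoord i
      rw [Nat.mul_succ] at h1
      omega
    obtain ⟨n, rfl⟩ := exists_add_of_le hle
    refine h ⟨n, ?_, ?_⟩
    · obtain ⟨⟨u, hu⟩, -⟩ := hn'
      obtain ⟨⟨v, hv⟩, -⟩ := hg
      simp only [Finsupp.add_apply] at hu
      have heven : Even (n 0 + n 1 + n 2) := ⟨u - v, by omega⟩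
      refine ⟨heven, ?_⟩
      by_contra! hlt
      have hlt' : n 0 + n 1 + 2 ≤ n 2 := by
        obtain ⟨w, hw⟩ := heven
        omega
      have h1 := Nat.mul_le_mul_left q hlt'
      have h2 := hK.lt_add
      have h3 := hcoord 0
      have h4 := hcoord 1
      have h5 := hcoord 2
      have h6 := hm.2
      simp only [Finsupp.add_apply, Nat.mul_add] at h1 h2 h3 h4 h5
      omega
    · refine Finsupp.ext fun i => ?_
      have h3 := hcoord i
      simp only [Finsupp.add_apply, Nat.mul_add, Finsupp.smul_apply, smul_eq_mul] at h3 ⊢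
      omega

theorem shiftMap_monomial_mul (hq : 0 < q) (hK : IsAdmissible q m₀ K) {g : Fin 3 →₀ ℕ}
    (hg : IsScroll g) {s : MvPolynomial (Fin 3) k} (hs : s ∈ Rscr k) :
    shiftMap q m₀ K (monomial (q • g) 1 * s) = monomial g 1 * shiftMap q m₀ K s := by
  refine Rscr_induction (P := fun s => shiftMap q m₀ K (monomial (q • g) 1 * s) =
    monomial g 1 * shiftMap q m₀ K s) hs (fun m hm => ?_) (fun s t h h' => ?_) (fun c s h => ?_)
  · rw [monomial_mul, one_mul, add_comm, shiftMap_monomial_add hq hK hm hg]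
  · rw [mul_add, map_add, h, h', map_add, mul_add]
  · rw [mul_smul_comm, map_smul, h, map_smul, mul_smul_comm]

end Monomials

section Functionals

variable {k} (p : ℕ) [Fact p.Prime] [CharP k p] (e : ℕ)

/-- The underlying polynomial of an element of `Mscr k p e`. -/
def toPoly : ↥(Mscr k p e) →+ MvPolynomial (Fin 3) k :=
  (Mscr k p e).subtype.toAddMonoidHom

theorem toPoly_injective : Function.Injective (toPoly (k := k) p e) := Subtype.val_injective

theorem toPoly_smul (r : ↥(Rscr k)) (v : ↥(Mscr k p e)) :
    toPoly p e (r • v) = r.1 ^ p ^ e * toPoly p e v := rfl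

theorem toPoly_mem_Rscr (v : ↥(Mscr k p e)) : toPoly p e v ∈ Rscr k := by
  obtain ⟨v, hv⟩ := v
  change (show MvPolynomial (Fin 3) k from v) ∈ Rscr k
  induction hv using Submodule.span_induction with
  | mem v hv =>
    obtain ⟨a, b, c, he, hc, rfl⟩ := hv
    exact X_pow_mul_mem_Rscr a b c he hc
  | zero => exact zero_mem (Rscr k)
  | add v w _ _ hv hw => exact (Rscr k).add_mem hv hw
  | smul r v _ hv => exact (Rscr k).mul_mem ((Rscr k).pow_mem r.2 _) hv

/-- The monomial `x^m`, as an element of `Mscr k p e`. -/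
def monM (m : Fin 3 →₀ ℕ) (hm : IsScroll m) : ↥(Mscr k p e) :=
  ⟨toESscr k p e (monomial m 1), Submodule.subset_span
    ⟨m 0, m 1, m 2, hm.1, hm.2, congrArg (toESscr k p e) (monomial_fin_three m)⟩⟩

theorem toPoly_monM (m : Fin 3 →₀ ℕ) (hm : IsScroll m) :
    toPoly (k := k) p e (monM p e m hm) = monomial m 1 := rfl

/-- The monomial `x^m`, as an element of `Rscr k`. -/
def monR (m : Fin 3 →₀ ℕ) (hm : IsScroll m) : ↥(Rscr k) := ⟨monomial m 1, monomial_mem_Rscr hm⟩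

theorem monR_smul_monM {m n : Fin 3 →₀ ℕ} (hm : IsScroll m) (hn : IsScroll n) :
    toPoly (k := k) p e (monR (k := k) m hm • monM (k := k) p e n hn) =
      monomial (p ^ e • m + n) 1 := by
  rw [toPoly_smul, toPoly_monM, monR, monomial_pow, monomial_mul, one_pow, one_mul]

variable [IsAlgClosed k]

theorem pow_map_mul_shiftMap {m₀ K : Fin 3 →₀ ℕ} (hK : IsAdmissible (p ^ e) m₀ K)
    {r s : MvPolynomial (Fin 3) k} (hr : r ∈ Rscr k) (hs : s ∈ Rscr k) :
    map (iterateFrobeniusEquiv k p e).symm.toRingHom (shiftMap (p ^ e) m₀ K (r ^ p ^ e * s)) =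
      r * map (iterateFrobeniusEquiv k p e).symm.toRingHom (shiftMap (p ^ e) m₀ K s) := by
  have hq : 0 < p ^ e := pow_pos (Fact.out : p.Prime).pos e
  refine Rscr_induction (P := fun r =>
    map (iterateFrobeniusEquiv k p e).symm.toRingHom (shiftMap (p ^ e) m₀ K (r ^ p ^ e * s)) =
      r * map (iterateFrobeniusEquiv k p e).symm.toRingHom (shiftMap (p ^ e) m₀ K s)) hr
    (fun m hm => ?_) (fun r t h h' => ?_) (fun c r h => ?_)
  · rw [monomial_pow, one_pow, shiftMap_monomial_mul hq hK hm hs, map_mul, map_monomial, map_one]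
  · rw [add_pow_expChar_pow, add_mul, map_add, map_add, h, h', add_mul]
  · rw [smul_pow, smul_mul_assoc, map_smul, smul_eq_C_mul, map_mul, map_C, h, smul_eq_C_mul,
      mul_assoc]
    congr 2
    exact (iterateFrobeniusEquiv k p e).symm_apply_apply c

/-- The `Rscr k`-linear functional on `Mscr k p e` with `x^m ↦ x^n` for
`m = m₀ + p ^ e (n - K)`. -/
def shiftFunctional {m₀ K : Fin 3 →₀ ℕ} (hK : IsAdmissible (p ^ e) m₀ K) :
    ↥(Mscr k p e) →ₗ[↥(Rscr k)] ↥(Rscr k) where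
  toFun v := ⟨map (iterateFrobeniusEquiv k p e).symm.toRingHom
    (shiftMap (p ^ e) m₀ K (toPoly p e v)), map_mem_Rscr _ (shiftMap_mem_Rscr _)⟩
  map_add' v w := Subtype.ext (by simp only [map_add]; rfl)
  map_smul' r v := Subtype.ext (by
    rw [toPoly_smul]
    exact pow_map_mul_shiftMap p e hK r.2 (toPoly_mem_Rscr p e v))

theorem shiftFunctional_monM {m₀ K m n : Fin 3 →₀ ℕ} (hK : IsAdmissible (p ^ e) m₀ K)
    (hm : IsScroll m) (hn : IsScroll n) (h : m + p ^ e • K = m₀ + p ^ e • n) :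
    shiftFunctional p e hK (monM p e m hm) = monR (k := k) n hn := by
  have hq : 0 < p ^ e := pow_pos (Fact.out : p.Prime).pos e
  refine Subtype.ext ?_
  change map _ (shiftMap (p ^ e) m₀ K (monomial m 1)) = monomial n 1
  rw [shiftMap_monomial hq hn h, map_monomial, map_one]

theorem shiftFunctional_monM_eq_zero {m₀ K m : Fin 3 →₀ ℕ} (hK : IsAdmissible (p ^ e) m₀ K)
    (hm : IsScroll m) (h : ¬ ∃ n, IsScroll n ∧ m + p ^ e • K = m₀ + p ^ e • n) :
    shiftFunctional (k := k) p e hK (monM p e m hm) = 0 := by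
  refine Subtype.ext ?_
  change map _ (shiftMap (p ^ e) m₀ K (monomial m 1)) = 0
  rw [shiftMap_monomial_eq_zero h, map_zero]

theorem card_le_rank_of_shiftFunctional {I T : Type} [Fintype I] [Fintype T]
    {m K : I → Fin 3 →₀ ℕ} (hm : ∀ i, IsScroll (m i)) (hK : ∀ i, IsAdmissible (p ^ e) (m i) (K i))
    (f : T → I) {K₀ : Fin 3 →₀ ℕ} (hK₀ : IsScroll K₀) (hf : ∀ t, K (f t) = K₀)
    (hinj : ∀ t t' n, IsScroll n →
      m (f t') + p ^ e • K₀ = m (f t) + p ^ e • n → t = t')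
    (x : ↥(Rscr k) →ₐ[k] k) (hx : x (monR K₀ hK₀) ≠ 0) :
    Fintype.card T ≤ ((Matrix.of fun i j =>
      shiftFunctional (k := k) p e (hK i) (monM p e (m j) (hm j))).map x).rank := by
  classical
  refine le_trans (le_of_eq ?_) (Matrix.rank_submatrix_le _ f f)
  rw [show Matrix.submatrix _ f f = Matrix.diagonal fun _ : T => x (monR K₀ hK₀) from ?_,
    Matrix.rank_of_isUnit]
  · rw [Matrix.isUnit_iff_isUnit_det, Matrix.det_diagonal]
    simp [hx]
  · ext t t'
    simp only [Matrix.submatrix_apply, Matrix.map_apply, Matrix.of_apply]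
    by_cases htt : t = t'
    · subst htt
      rw [Matrix.diagonal_apply_eq, shiftFunctional_monM p e (hK _) (hm _) hK₀ (by rw [hf])]
    · rw [Matrix.diagonal_apply_ne _ htt, shiftFunctional_monM_eq_zero, map_zero]
      rintro ⟨n, hn, h⟩
      rw [hf] at h
      exact htt (hinj t t' n hn h)

end Functionals

section Families

/-- The exponents `(a, b, c)` of the monomials of `Rscr k` with `a, b, c < q`. -/
def boxSet (q : ℕ) : Finset (ℕ × ℕ × ℕ) :=
  (Finset.range q ×ˢ Finset.range q ×ˢ Finset.range q).filter
    fun t => Even (t.1 + t.2.1 + t.2.2) ∧ t.2.2 ≤ t.1 + t.2.1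

theorem mem_boxSet {q a b c : ℕ} :
    (a, b, c) ∈ boxSet q ↔ a < q ∧ b < q ∧ c < q ∧ Even (a + b + c) ∧ c ≤ a + b := by
  simp [boxSet, and_assoc]

theorem card_boxSet_add_three_le {q : ℕ} (hq : 2 < q) : (boxSet q).card + 3 ≤ q ^ 3 := by
  have h1 : boxSet q ⊆ ((Finset.range q ×ˢ Finset.range q ×ˢ Finset.range q) \
      {(1, 0, 0), (0, 1, 0), (1, 1, 1)}) := by
    rintro ⟨a, b, c⟩ h
    rw [mem_boxSet] at h
    obtain ⟨ha, hb, hc, he, -⟩ := h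
    simp only [Finset.mem_sdiff, Finset.mem_product, Finset.mem_range, Finset.mem_insert,
      Finset.mem_singleton, Prod.mk.injEq, Nat.even_iff] at he ⊢
    omega
  have h2 := Finset.card_le_card h1
  rw [Finset.card_sdiff_of_subset] at h2
  · have h3 : ({(1, 0, 0), (0, 1, 0), (1, 1, 1)} : Finset (ℕ × ℕ × ℕ)).card = 3 := by decide
    have h4 : (Finset.range q ×ˢ Finset.range q ×ˢ Finset.range q).card = q ^ 3 := by
      simp only [Finset.card_product, Finset.card_range]
      ring
    have h5 : 3 ^ 3 ≤ q ^ 3 := Nat.pow_le_pow_left hq 3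
    rw [h3, h4] at h2
    omega
  · intro t ht
    simp only [Finset.mem_insert, Finset.mem_singleton] at ht
    rcases ht with rfl | rfl | rfl <;> simp <;> omega

theorem card_boxSet (q : ℕ) : (boxSet q).card =
    ((Finset.Ico (0 : ℤ) q ×ˢ Finset.Ico (0 : ℤ) q ×ˢ Finset.Ico (0 : ℤ) q).filter
      (fun t => Even (t.1 + t.2.1 + t.2.2) ∧ t.2.2 ≤ t.1 + t.2.1)).card := by
  refine Finset.card_bij (fun t _ => ((t.1 : ℤ), (t.2.1 : ℤ), (t.2.2 : ℤ))) ?_ ?_ ?_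
  · rintro ⟨a, b, c⟩ h
    rw [mem_boxSet] at h
    obtain ⟨ha, hb, hc, he, hle⟩ := h
    simp only [Finset.mem_filter, Finset.mem_product, Finset.mem_Ico]
    exact ⟨by omega, by exact_mod_cast he, by exact_mod_cast hle⟩
  · rintro ⟨a, b, c⟩ _ ⟨a', b', c'⟩ _ h
    simpa using h
  · rintro ⟨a, b, c⟩ h
    simp only [Finset.mem_filter, Finset.mem_product, Finset.mem_Ico] at h
    obtain ⟨⟨⟨ha, ha'⟩, ⟨hb, hb'⟩, hc, hc'⟩, he, hle⟩ := h
    lift a to ℕ using ha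
    lift b to ℕ using hb
    lift c to ℕ using hc
    exact ⟨(a, b, c), mem_boxSet.2 ⟨by omega, by omega, by omega, by exact_mod_cast he,
      by exact_mod_cast hle⟩, rfl⟩

theorem eq_and_eq_of_add_mul_eq {q i i' u s : ℕ} (hi : i < q) (hi' : i' < q)
    (h : i' + q * u = i + q * s) : i = i' ∧ s = u := by
  have h1 := congrArg (· % q) h
  simp only [Nat.add_mul_mod_self_left, Nat.mod_eq_of_lt hi, Nat.mod_eq_of_lt hi'] at h1
  subst h1
  exact ⟨rfl, (Nat.eq_of_mul_eq_mul_left (by omega) (add_left_cancel h)).symm⟩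

/-- The index set of `familyBase`. -/
abbrev FamilyIndex (q : ℕ) : Type := ↥(boxSet q) ⊕ Fin 4 × Fin q × Fin q × Fin q

/-- Exponents representing the residue classes modulo `q`: those of the monomials in the box, and
four complete systems of representatives, one for each of the extremal rays spanned by
`x²`, `y²`, `xz`, `yz`. -/
def familyBase (q : ℕ) : FamilyIndex q → (Fin 3 →₀ ℕ)
  | .inl t => tri t.1.1 t.1.2.1 t.1.2.2
  | .inr (j, i, b, c) =>
    ![tri (2 * q + 2 * i + (b + c) % 2) b c, tri b (2 * q + 2 * i + (b + c) % 2) c,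
      tri (2 * c + (2 * q + i) - b) b (2 * q + i), tri b (2 * c + (2 * q + i) - b) (2 * q + i)] j

/-- A multiple of the generator of the `j`-th extremal ray. -/
def rayShift (j : Fin 4) : Fin 3 →₀ ℕ := ![tri 4 0 0, tri 0 4 0, tri 5 0 5, tri 0 5 5] j

/-- The shifts going with `familyBase`. -/
def familyShift (q : ℕ) : FamilyIndex q → (Fin 3 →₀ ℕ)
  | .inl _ => 0
  | .inr (j, _) => rayShift j

theorem isScroll_rayShift (j : Fin 4) : IsScroll (rayShift j) := by
  fin_cases j <;> exact ⟨by decide, by decide⟩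

theorem isScroll_familyBase {q : ℕ} (i : FamilyIndex q) : IsScroll (familyBase q i) := by
  rcases i with ⟨⟨a, b, c⟩, h⟩ | ⟨j, i, b, c⟩
  · rw [mem_boxSet] at h
    exact h.2.2.2
  · have hb := b.2
    have hc := c.2
    fin_cases j <;>
      simp [IsScroll, familyBase, Nat.even_iff] <;> omega

theorem isAdmissible_family {q : ℕ} (i : FamilyIndex q) :
    IsAdmissible q (familyBase q i) (familyShift q i) := by
  rcases i with ⟨⟨a, b, c⟩, h⟩ | ⟨j, i, b, c⟩
  · rw [mem_boxSet] at h
    refine ⟨fun l => ?_, ?_⟩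
    · fin_cases l <;> simp [familyBase, familyShift] <;> omega
    · simp [familyBase, familyShift]
      omega
  · have hi := i.2
    have hb := b.2
    have hc := c.2
    refine ⟨fun l => ?_, ?_⟩
    · fin_cases j <;> fin_cases l <;> simp [familyBase, familyShift, rayShift] <;> omega
    · fin_cases j <;> simp [familyBase, familyShift, rayShift] <;> omega

theorem familyBase_inl_injective {q : ℕ} (t t' : ↥(boxSet q)) (n : Fin 3 →₀ ℕ)
    (h : familyBase q (.inl t') + q • (0 : Fin 3 →₀ ℕ) = familyBase q (.inl t) + q • n) :
    t = t' := by
  obtain ⟨⟨a, b, c⟩, ht⟩ := t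
  obtain ⟨⟨a', b', c'⟩, ht'⟩ := t'
  rw [mem_boxSet] at ht ht'
  have h0 := DFunLike.congr_fun h 0
  have h1 := DFunLike.congr_fun h 1
  have h2 := DFunLike.congr_fun h 2
  simp only [familyBase, smul_zero, add_zero, Finsupp.add_apply, Finsupp.smul_apply, smul_eq_mul,
    tri_zero, tri_one, tri_two] at h0 h1 h2
  simp only [Subtype.mk.injEq, Prod.mk.injEq]
  exact ⟨(eq_and_eq_of_add_mul_eq (u := 0) ht.1 ht'.1 h0).1,
    (eq_and_eq_of_add_mul_eq (u := 0) ht.2.1 ht'.2.1 h1).1,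
    (eq_and_eq_of_add_mul_eq (u := 0) ht.2.2.1 ht'.2.2.1 h2).1⟩

theorem eq_of_plane_ray {q i b c i' b' c' n₀ n₁ n₂ : ℕ} (hi : i < q) (hb : b < q) (hc : c < q)
    (hi' : i' < q) (hb' : b' < q) (hc' : c' < q) (hn : Even (n₀ + n₁ + n₂))
    (h0 : 2 * q + 2 * i' + (b' + c') % 2 + q * 4 = 2 * q + 2 * i + (b + c) % 2 + q * n₀)
    (h1 : b' = b + q * n₁) (h2 : c' = c + q * n₂) : i = i' ∧ b = b' ∧ c = c' := by
  obtain ⟨rfl, rfl⟩ := eq_and_eq_of_add_mul_eq (u := 0) hb hb' h1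
  obtain ⟨rfl, rfl⟩ := eq_and_eq_of_add_mul_eq (u := 0) hc hc' h2
  obtain ⟨s, hs⟩ := hn
  obtain rfl : n₀ = 2 * s := by omega
  rw [mul_left_comm] at h0
  have h3 : i' + q * 2 = i + q * s := by omega
  exact ⟨(eq_and_eq_of_add_mul_eq hi hi' h3).1, rfl, rfl⟩

theorem eq_of_slant_ray {q i b c i' b' c' n₀ n₁ n₂ : ℕ} (hi : i < q) (hb : b < q) (hc : c < q)
    (hi' : i' < q) (hb' : b' < q) (hc' : c' < q) (hn : Even (n₀ + n₁ + n₂))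
    (h0 : 2 * c' + (2 * q + i') - b' + q * 5 = 2 * c + (2 * q + i) - b + q * n₀)
    (h1 : b' = b + q * n₁) (h2 : 2 * q + i' + q * 5 = 2 * q + i + q * n₂) :
    i = i' ∧ b = b' ∧ c = c' := by
  obtain ⟨rfl, rfl⟩ := eq_and_eq_of_add_mul_eq (u := 0) hb hb' h1
  have h3 : i' + q * 5 = i + q * n₂ := by omega
  obtain ⟨rfl, rfl⟩ := eq_and_eq_of_add_mul_eq hi hi' h3
  obtain ⟨s, hs⟩ := hn
  obtain ⟨w, rfl⟩ : ∃ w, n₀ = 2 * w + 1 := ⟨s - 3, by omega⟩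
  rw [mul_add, mul_one, mul_left_comm] at h0
  have h4 : c' + q * 2 = c + q * w := by omega
  exact ⟨rfl, rfl, (eq_and_eq_of_add_mul_eq hc hc' h4).1⟩

theorem familyBase_inr_injective {q : ℕ} (j : Fin 4) (t t' : Fin q × Fin q × Fin q)
    (n : Fin 3 →₀ ℕ) (hn : IsScroll n)
    (h : familyBase q (.inr (j, t')) + q • rayShift j = familyBase q (.inr (j, t)) + q • n) :
    t = t' := by
  obtain ⟨⟨i, hi⟩, ⟨b, hb⟩, ⟨c, hc⟩⟩ := t
  obtain ⟨⟨i', hi'⟩, ⟨b', hb'⟩, ⟨c', hc'⟩⟩ := t'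
  have h0 := DFunLike.congr_fun h 0
  have h1 := DFunLike.congr_fun h 1
  have h2 := DFunLike.congr_fun h 2
  have hn' : Even (n 1 + n 0 + n 2) := add_comm (n 0) (n 1) ▸ hn.1
  simp only [Prod.mk.injEq, Fin.mk.injEq]
  fin_cases j <;>
    simp [familyBase, rayShift] at h0 h1 h2
  · exact eq_of_plane_ray hi hb hc hi' hb' hc' hn.1 (by omega) h1 h2
  · exact eq_of_plane_ray hi hb hc hi' hb' hc' hn' (by omega) h0 h2
  · exact eq_of_slant_ray hi hb hc hi' hb' hc' hn.1 (by omega) h1 (by omega)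
  · exact eq_of_slant_ray hi hb hc hi' hb' hc' hn' (by omega) h0 (by omega)

variable {k}

theorem exists_map_monR_rayShift_ne_zero (x : ↥(Rscr k) →ₐ[k] k)
    (hx : ¬ ∀ i, x (scrollGen i) = 0) : ∃ j, x (monR (rayShift j) (isScroll_rayShift j)) ≠ 0 := by
  by_contra! h
  have e0 : (monR (rayShift 0) (isScroll_rayShift 0) : ↥(Rscr k)) = scrollGen 0 ^ 2 :=
    Subtype.ext (by simp [monR, rayShift, scrollGen, monomial_fin_three]; ring)
  have e1 : (monR (rayShift 1) (isScroll_rayShift 1) : ↥(Rscr k)) = scrollGen 2 ^ 2 :=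
    Subtype.ext (by simp [monR, rayShift, scrollGen, monomial_fin_three]; ring)
  have e2 : (monR (rayShift 2) (isScroll_rayShift 2) : ↥(Rscr k)) = scrollGen 3 ^ 5 :=
    Subtype.ext (by simp [monR, rayShift, scrollGen, monomial_fin_three]; ring)
  have e3 : (monR (rayShift 3) (isScroll_rayShift 3) : ↥(Rscr k)) = scrollGen 4 ^ 5 :=
    Subtype.ext (by simp [monR, rayShift, scrollGen, monomial_fin_three]; ring)
  have h0 := h 0
  have h1 := h 1
  have h2 := h 2
  have h3 := h 3
  rw [e0, map_pow] at h0
  rw [e1, map_pow] at h1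
  rw [e2, map_pow] at h2
  rw [e3, map_pow] at h3
  have h4 := congrArg x scrollGen_mul_two
  rw [map_mul, map_pow, pow_eq_zero_iff two_ne_zero |>.1 h0, zero_mul] at h4
  refine hx fun i => ?_
  fin_cases i
  · exact pow_eq_zero_iff two_ne_zero |>.1 h0
  · exact pow_eq_zero_iff two_ne_zero |>.1 h4.symm
  · exact pow_eq_zero_iff two_ne_zero |>.1 h1
  · exact pow_eq_zero_iff (by norm_num) |>.1 h2
  · exact pow_eq_zero_iff (by norm_num) |>.1 h3

variable (p : ℕ) [Fact p.Prime] [CharP k p] (e : ℕ) [IsAlgClosed k]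

/-- The pairing matrix between the functionals and the monomials of the families above. -/
def familyMatrix : Matrix (FamilyIndex (p ^ e)) (FamilyIndex (p ^ e)) ↥(Rscr k) :=
  Matrix.of fun i j => shiftFunctional (k := k) p e (isAdmissible_family i)
    (monM p e (familyBase (p ^ e) j) (isScroll_familyBase j))

theorem card_boxSet_le_rank_familyMatrix (x : ↥(Rscr k) →ₐ[k] k) :
    (boxSet (p ^ e)).card ≤ ((familyMatrix p e).map x).rank := by
  rw [← Fintype.card_coe]
  have h0 : IsScroll 0 := ⟨by simp, by simp⟩
  refine card_le_rank_of_shiftFunctional p e isScroll_familyBase isAdmissible_family Sum.inl h0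
    (fun _ => rfl) (fun t t' n _ h => familyBase_inl_injective t t' n h) x ?_
  have : (monR 0 h0 : ↥(Rscr k)) = 1 := rfl
  rw [this, map_one]
  exact one_ne_zero

theorem pow_three_le_rank_familyMatrix (x : ↥(Rscr k) →ₐ[k] k)
    (hx : ¬ ∀ i, x (scrollGen i) = 0) : (p ^ e) ^ 3 ≤ ((familyMatrix p e).map x).rank := by
  obtain ⟨j, hj⟩ := exists_map_monR_rayShift_ne_zero x hx
  have hcard : (p ^ e) ^ 3 = Fintype.card (Fin (p ^ e) × Fin (p ^ e) × Fin (p ^ e)) := by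
    simp only [Fintype.card_prod, Fintype.card_fin]
    ring
  rw [hcard]
  exact card_le_rank_of_shiftFunctional p e isScroll_familyBase isAdmissible_family
    (fun t => Sum.inr (j, t)) (isScroll_rayShift j) (fun _ => rfl)
    (familyBase_inr_injective j) x hj

end Families

section FreeRank

variable {k}

theorem Matrix.rank_map_apply_le {K A M N I J : Type*} [Field K] [CommRing A] [AddCommGroup M]
    [Module A M] [AddCommGroup N] [Module A N] [Fintype I] [Fintype J] {a : ℕ}
    (φ : M ≃ₗ[A] (Fin a → A) × N) (F : I → M →ₗ[A] A) (V : J → M) (x : A →+* K) :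
    ((Matrix.of fun i j => F i (V j)).map x).rank ≤
      ((Matrix.of fun i j => F i (φ.symm (0, (φ (V j)).2))).map x).rank + a := by
  let B : Matrix I (Fin a) A := Matrix.of fun i l => F i (φ.symm (Pi.single l 1, 0))
  let D : Matrix (Fin a) J A := Matrix.of fun l j => (φ (V j)).1 l
  have h : (Matrix.of fun i j => F i (V j)) =
      (Matrix.of fun i j => F i (φ.symm (0, (φ (V j)).2))) + B * D := by
    ext i j
    have hV : V j = φ.symm (0, (φ (V j)).2) +
        ∑ l, (φ (V j)).1 l • φ.symm (Pi.single l 1, 0) := by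
      apply φ.injective
      simp only [map_add, map_sum, map_smul, LinearEquiv.apply_symm_apply]
      refine Prod.ext ?_ ?_
      · simp only [Prod.fst_add, Prod.fst_sum, Prod.smul_mk, zero_add]
        exact pi_eq_sum_univ' _
      · simp [Prod.snd_sum]
    simp only [Matrix.of_apply, Matrix.add_apply, Matrix.mul_apply, B, D]
    conv_lhs => rw [hV]
    simp only [map_add, map_sum, map_smul, smul_eq_mul, mul_comm]
  rw [h, Matrix.map_add _ (map_add x), Matrix.map_mul]
  refine (Matrix.rank_add_le' _ _).trans (Nat.add_le_add_left ?_ _)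
  refine (Matrix.rank_mul_le_left _ _).trans ?_
  simpa using Matrix.rank_le_card_width (B.map x)

theorem coeff_zero_eq_zero_of_X_mul_eq {i j : Fin 3} (hij : i ≠ j) {F G : MvPolynomial (Fin 3) k}
    (h : X i * F = X j * G) : coeff 0 F = 0 := by
  classical
  have h1 := congrArg (coeff (Finsupp.single i 1 + 0)) h
  rw [coeff_X_mul, coeff_X_mul', if_neg] at h1
  · exact h1
  · rw [add_zero, Finsupp.support_single (hb := one_ne_zero)]
    simpa using hij.symm

/-- The `k`-point of `Rscr k` at the irrelevant maximal ideal. -/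
def originHom : ↥(Rscr k) →ₐ[k] k := (aeval 0).comp (Rscr k).val

theorem originHom_apply (r : ↥(Rscr k)) : originHom r = coeff 0 r.1 := by
  change aeval 0 r.1 = _
  rw [aeval_zero]
  rfl

variable (p : ℕ) [Fact p.Prime] [CharP k p] (e : ℕ)

theorem originHom_apply_monM_eq_zero (f : ↥(Mscr k p e) →ₗ[↥(Rscr k)] ↥(Rscr k)) {i j l : Fin 3}
    (hij : i ≠ j) {g g' m m' : Fin 3 →₀ ℕ} (hg : IsScroll g) (hg' : IsScroll g') (hm : IsScroll m)
    (hm' : IsScroll m') (h : p ^ e • g + m = p ^ e • g' + m')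
    (hi : (monomial g 1 : MvPolynomial (Fin 3) k) = X l * X i)
    (hj : (monomial g' 1 : MvPolynomial (Fin 3) k) = X l * X j) :
    originHom (f (monM p e m hm)) = 0 := by
  have h1 : monR (k := k) g hg • monM (k := k) p e m hm = monR (k := k) g' hg' • monM p e m' hm' :=
    toPoly_injective p e (by rw [monR_smul_monM, monR_smul_monM, h])
  have h2 := congrArg (fun v => (f v).1) h1
  simp only [map_smul, smul_eq_mul] at h2
  change monomial g 1 * (f (monM p e m hm)).1 = monomial g' 1 * (f (monM p e m' hm')).1 at h2
  rw [hi, hj, mul_assoc, mul_assoc] at h2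
  rw [originHom_apply]
  exact coeff_zero_eq_zero_of_X_mul_eq hij (mul_left_cancel₀ (X_ne_zero l) h2)

theorem originHom_apply_monM_eq_zero_of_notMem_boxSet
    (f : ↥(Mscr k p e) →ₗ[↥(Rscr k)] ↥(Rscr k)) {a b c : ℕ} (hm : IsScroll (tri a b c))
    (h : (a, b, c) ∉ boxSet (p ^ e)) : originHom (f (monM p e (tri a b c) hm)) = 0 := by
  rw [mem_boxSet] at h
  obtain ⟨⟨s, hs⟩, hc⟩ := hm
  simp only [tri_zero, tri_one, tri_two] at hs hc
  have h' : p ^ e ≤ a ∨ p ^ e ≤ b ∨ (a < p ^ e ∧ b < p ^ e ∧ p ^ e ≤ c) := by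
    by_contra! hlt
    exact h ⟨hlt.1, hlt.2.1, hlt.2.2 hlt.1 hlt.2.1, ⟨s, hs⟩, hc⟩
  have h200 : IsScroll (tri 2 0 0) := ⟨by decide, by decide⟩
  have h020 : IsScroll (tri 0 2 0) := ⟨by decide, by decide⟩
  have h110 : IsScroll (tri 1 1 0) := ⟨by decide, by decide⟩
  have h101 : IsScroll (tri 1 0 1) := ⟨by decide, by decide⟩
  rcases h' with h' | h' | ⟨ha, hb, h'⟩
  · refine originHom_apply_monM_eq_zero p e f (i := 1) (j := 0) (l := 0) (by decide)
      (m' := tri (a - p ^ e) (b + p ^ e) c) h110 h200 _ ⟨⟨s, ?_⟩, ?_⟩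
      (ext_fin_three ?_ ?_ ?_) ?_ ?_
    any_goals simp <;> omega
    all_goals simp [monomial_fin_three, sq]
  · refine originHom_apply_monM_eq_zero p e f (i := 0) (j := 1) (l := 1) (by decide)
      (m' := tri (a + p ^ e) (b - p ^ e) c) h110 h020 _ ⟨⟨s, ?_⟩, ?_⟩
      (ext_fin_three ?_ ?_ ?_) ?_ ?_
    any_goals simp <;> omega
    all_goals simp [monomial_fin_three, sq, mul_comm]
  · refine originHom_apply_monM_eq_zero p e f (i := 0) (j := 2) (l := 0) (by decide)
      (m' := tri (a + p ^ e) b (c - p ^ e)) h200 h101 _ ⟨⟨s, ?_⟩, ?_⟩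
      (ext_fin_three ?_ ?_ ?_) ?_ ?_
    any_goals simp <;> omega
    all_goals simp [monomial_fin_three, sq]

theorem le_card_boxSet_of_surjective {a : ℕ}
    (f : ↥(Mscr k p e) →ₗ[↥(Rscr k)] (Fin a → ↥(Rscr k))) (hf : Function.Surjective f) :
    a ≤ (boxSet (p ^ e)).card := by
  classical
  let g : ↥(boxSet (p ^ e)) → Fin a → k := fun t l =>
    originHom (f (monM p e (tri t.1.1 t.1.2.1 t.1.2.2) (mem_boxSet.1 t.2).2.2.2) l)
  have hmem : ∀ v, (fun l => originHom (f v l)) ∈ Submodule.span k (Set.range g) := by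
    rintro ⟨v, hv⟩
    induction hv using Submodule.span_induction with
    | mem v hv =>
      obtain ⟨b, c, d, he, hd, rfl⟩ := hv
      have hm : IsScroll (tri b c d) := ⟨he, hd⟩
      have hv : monM p e (tri b c d) hm = ⟨toESscr k p e (X 0 ^ b * X 1 ^ c * X 2 ^ d),
          Submodule.subset_span ⟨b, c, d, he, hd, rfl⟩⟩ :=
        Subtype.ext (congrArg (toESscr k p e) (monomial_fin_three _))
      rw [← hv]
      by_cases hbox : (b, c, d) ∈ boxSet (p ^ e)
      · exact Submodule.subset_span ⟨⟨_, hbox⟩, rfl⟩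
      · convert Submodule.zero_mem _
        exact originHom_apply_monM_eq_zero_of_notMem_boxSet p e
          (LinearMap.proj (R := ↥(Rscr k)) (φ := fun _ => ↥(Rscr k)) _ ∘ₗ f) hm hbox
    | zero =>
      convert Submodule.zero_mem _ with l
      rw [show (⟨0, _⟩ : ↥(Mscr k p e)) = 0 from rfl, map_zero, Pi.zero_apply, map_zero,
        Pi.zero_apply]
    | add v w hv hw ihv ihw =>
      convert Submodule.add_mem _ ihv ihw with l
      rw [Pi.add_apply, ← map_add, ← Pi.add_apply, ← map_add]
      rfl
    | smul r v hv ih =>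
      convert Submodule.smul_mem _ (originHom r) ih with l
      rw [Pi.smul_apply, smul_eq_mul, ← map_mul, ← smul_eq_mul, ← Pi.smul_apply, ← map_smul]
      rfl
  have htop : Submodule.span k (Set.range g) = ⊤ := by
    refine Submodule.eq_top_iff'.2 fun y => ?_
    obtain ⟨v, hv⟩ := hf fun l => algebraMap k _ (y l)
    convert hmem v
    rw [hv, AlgHom.commutes]
    rfl
  have hcard := finrank_range_le_card (R := k) g
  rw [Set.finrank, htop, finrank_top, Module.finrank_fin_fun, Fintype.card_coe] at hcard
  exact hcard

variable [IsAlgClosed k]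

theorem card_boxSet_le_of_equiv (hq : 2 < p ^ e) {a : ℕ} {N : Type*} [AddCommGroup N]
    [Module ↥(Rscr k) N] (φ : ↥(Mscr k p e) ≃ₗ[↥(Rscr k)] (Fin a → ↥(Rscr k)) × N)
    (hN : ∀ f : N →ₗ[↥(Rscr k)] ↥(Rscr k), ¬ Function.Surjective f) :
    (boxSet (p ^ e)).card ≤ a := by
  by_contra! hlt
  let F i := shiftFunctional (k := k) p e (isAdmissible_family (q := p ^ e) i)
  let V j := monM (k := k) p e (familyBase (p ^ e) j) (isScroll_familyBase j)
  let G : Matrix (FamilyIndex (p ^ e)) (FamilyIndex (p ^ e)) ↥(Rscr k) :=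
    Matrix.of fun i j => F i (φ.symm (0, (φ (V j)).2))
  have hG (x : ↥(Rscr k) →ₐ[k] k) : ((familyMatrix p e).map x).rank ≤ (G.map x).rank + a :=
    Matrix.rank_map_apply_le φ F V (x : ↥(Rscr k) →+* k)
  obtain ⟨c, hc⟩ := exists_vecMul_map_ne_zero G
    (fun x _ => by
      have h1 := card_boxSet_le_rank_familyMatrix p e x
      have h2 := hG x
      omega)
    (fun x hx => by
      have h1 := pow_three_le_rank_familyMatrix p e x hx
      have h2 := hG x
      have h3 := card_boxSet_add_three_le hq
      omega)
  let f : N →ₗ[↥(Rscr k)] ↥(Rscr k) :=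
    ∑ i, algebraMap k ↥(Rscr k) (c i) • (F i ∘ₗ φ.symm.toLinearMap ∘ₗ LinearMap.inr _ _ _)
  have := Rscr_finiteType (k := k)
  refine hN f (LinearMap.surjective_of_forall_algHom
    (fun m hm => exists_algHom_eq_zero_of_isMaximal (k := k) m) f fun x => ?_)
  obtain ⟨j, hj⟩ := Function.ne_iff.1 (hc x)
  refine ⟨(φ (V j)).2, fun h0 => hj ?_⟩
  rw [Pi.zero_apply, ← h0]
  simp [f, G, Matrix.vecMul, dotProduct, map_sum]

end FreeRank
theorem free_rank_of_summand_eq_count (p : ℕ) [Fact p.Prime] (k : Type) [Field k]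
    [IsAlgClosed k] [CharP k p] (e : ℕ) (hq : 2 < p ^ e) (a : ℕ) (N : ModuleCat ↥(Rscr k))
    (hiso : Nonempty (↥(Mscr k p e) ≃ₗ[↥(Rscr k)] ((Fin a → ↥(Rscr k)) × ↥N)))
    (hnofree : ¬ ∃ N' : ModuleCat ↥(Rscr k),
      Nonempty (↥N ≃ₗ[↥(Rscr k)] (↥(Rscr k) × ↥N'))) :
    a = (((Finset.Ico (0 : ℤ) (p ^ e) ×ˢ Finset.Ico (0 : ℤ) (p ^ e) ×ˢ
        Finset.Ico (0 : ℤ) (p ^ e)).filter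
      (fun t => Even (t.1 + t.2.1 + t.2.2) ∧ t.2.2 ≤ t.1 + t.2.1)).card) := by
  obtain ⟨φ⟩ := hiso
  have hN (f : ↥N →ₗ[↥(Rscr k)] ↥(Rscr k)) : ¬ Function.Surjective f := fun hf => by
    obtain ⟨ψ⟩ := LinearMap.nonempty_equiv_prod_ker_of_surjective f hf
    let ι : ↥(LinearMap.ker f) →ₗ[↥(Rscr k)] ↥(Mscr k p e) :=
      φ.symm.toLinearMap ∘ₗ LinearMap.inr _ _ _ ∘ₗ (LinearMap.ker f).subtype
    have hι : Function.Injective ι :=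
      φ.symm.injective.comp (LinearMap.inr_injective.comp Subtype.val_injective)
    exact hnofree ⟨ModuleCat.of _ (ULift ↥(LinearMap.range ι)),
      ⟨ψ.trans ((LinearEquiv.refl _ _).prodCongr
        ((LinearEquiv.ofInjective ι hι).trans ULift.moduleEquiv.symm))⟩⟩
  have hcard := card_boxSet (p ^ e)
  push_cast at hcard
  rw [← hcard]
  exact le_antisymm
    (le_card_boxSet_of_surjective p e (LinearMap.fst _ _ _ ∘ₗ φ.toLinearMap)
      (Prod.fst_surjective.comp φ.surjective))
    (card_boxSet_le_of_equiv p e hq φ hN)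
end
end
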